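/- arXiv:1808.08679 — 2 statements merged into one kernel-verified Lean document; each statement's English description precedes it below -/
import Mathlib

section
/- For every nonnegative integer vector μ = (μ_1,…,μ_n) with sum d and every nonnegative integer k, the number of symmetric n×n matrices with nonnegative integer entries, row sums μ_1,…,μ_n, and exactly k odd entries on the main diagonal equals the number of semistandard Young tableaux of weight μ whose shape λ (a partition of d) has exactly k odd parts (odd rows). -/
/-- The weight of a semistandard Young tableau: `ssytWeight T i` is the number of cells of the
tableau whose entry equals `i`. -/
def ssytWeight {μ : YoungDiagram} (T : SemistandardYoungTableau μ) (i : ℕ) : ℕ :=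
  (μ.cells.filter fun c => T c.1 c.2 = i).card

/-- `tabCard μ ν` is the number of semistandard Young tableaux of shape `μ` and weight `ν`,
where `ν : Fin n → ℕ`: the entry `j` (for `j < n`) occurs exactly `ν j` times, and no entry
`≥ n` occurs. -/
noncomputable def tabCard (μ : YoungDiagram) {n : ℕ} (ν : Fin n → ℕ) : ℕ :=
  Set.ncard {T : SemistandardYoungTableau μ |
    ∀ j : ℕ, ssytWeight T j = if h : j < n then ν ⟨j, h⟩ else 0}

/-- The Schur polynomial `s_μ(x_0, …, x_{n-1})`, as the generating function of semistandard
Young tableaux of shape `μ` with entries in `{0, …, n-1}`. -/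
noncomputable def schurPoly (n : ℕ) (μ : YoungDiagram) : MvPolynomial (Fin n) ℤ :=
  ∑ᶠ (T : SemistandardYoungTableau μ) (_ : ∀ c ∈ μ.cells, T c.1 c.2 < n),
    ∏ i : Fin n, (MvPolynomial.X i : MvPolynomial (Fin n) ℤ) ^ ssytWeight T (i : ℕ)

/-- The number of odd rows (odd parts) of a Young diagram. -/
def oddRowsCount (lam : YoungDiagram) : ℕ :=
  lam.rowLens.countP fun r => r % 2 = 1

/-- The number of odd columns of a Young diagram. -/
def oddColsCount (lam : YoungDiagram) : ℕ :=
  oddRowsCount lam.transpose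

/-- A Young diagram is a *threshold* partition if its Frobenius coordinates satisfy
`β i = α i + 1` for each `i` up to the Durfee rank; with 0-indexed diagrams this says that
`colLen i = rowLen i + 1` for each diagonal cell `(i, i)`. -/
def YoungDiagram.IsThreshold (lam : YoungDiagram) : Prop :=
  ∀ i : ℕ, (i, i) ∈ lam → lam.colLen i = lam.rowLen i + 1


namespace YoungDiagram

/-- `κ.Interlaces lam` says that `lam / κ` is a horizontal strip. -/
def Interlaces (κ lam : YoungDiagram) : Prop :=
  ∀ i, κ.rowLen i ≤ lam.rowLen i ∧ lam.rowLen (i + 1) ≤ κ.rowLen i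

theorem ext_rowLen {κ lam : YoungDiagram} (h : ∀ i, κ.rowLen i = lam.rowLen i) : κ = lam := by
  ext ⟨i, j⟩
  rw [mem_cells, mem_cells, mem_iff_lt_rowLen, mem_iff_lt_rowLen, h]

theorem exists_rowLen_eq_zero (κ : YoungDiagram) : ∃ N, ∀ i, N ≤ i → κ.rowLen i = 0 := by
  refine ⟨κ.colLen 0, fun i hi => ?_⟩
  by_contra h
  have : (i, 0) ∈ κ := mem_iff_lt_rowLen.2 (Nat.pos_of_ne_zero h)
  rw [mem_iff_lt_colLen] at this
  omega

theorem card_eq_sum_rowLen (κ : YoungDiagram) {N : ℕ} (hN : κ.rowLen N = 0) :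
    κ.card = ∑ i ∈ Finset.range N, κ.rowLen i := by
  have hmaps : ∀ c ∈ κ.cells, c.1 ∈ Finset.range N := by
    rintro ⟨i, j⟩ hc
    rw [mem_cells, mem_iff_lt_rowLen] at hc
    rw [Finset.mem_range]
    by_contra h
    have := κ.rowLen_anti N i (not_lt.1 h)
    omega
  rw [YoungDiagram.card, Finset.card_eq_sum_card_fiberwise hmaps]
  exact Finset.sum_congr rfl fun i _ => (rowLen_eq_card κ).symm

theorem oddRowsCount_eq_sum (κ : YoungDiagram) {N : ℕ} (hN : κ.rowLen N = 0) :
    oddRowsCount κ = ∑ i ∈ Finset.range N, κ.rowLen i % 2 := by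
  have hle : κ.colLen 0 ≤ N := by
    by_contra h
    have := mem_iff_lt_rowLen.1 (mem_iff_lt_colLen.2 (not_le.1 h))
    omega
  have hsub : Finset.range (κ.colLen 0) ⊆ Finset.range N := by simpa using hle
  rw [← Finset.sum_subset hsub]
  · unfold oddRowsCount rowLens
    generalize κ.colLen 0 = M
    induction M with
    | zero => simp
    | succ M ih =>
      rw [List.range_succ, List.map_append, List.countP_append, ih, Finset.sum_range_succ]
      rcases Nat.mod_two_eq_zero_or_one (κ.rowLen M) with h | h <;> simp [h]
  · intro i _ hi
    by_contra h
    apply hi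
    rw [Finset.mem_range, ← mem_iff_lt_colLen, mem_iff_lt_rowLen]
    by_contra h'
    apply h
    simp [Nat.eq_zero_of_not_pos h']

/-- The Young diagram with prescribed row lengths. -/
def ofRowFun (f : ℕ → ℕ) (hf : Antitone f) (h0 : ∃ N, f N = 0) : YoungDiagram where
  cells := (Finset.range (Nat.find h0) ×ˢ Finset.range (f 0)).filter fun c => c.2 < f c.1
  isLowerSet := by
    rintro ⟨i, j⟩ ⟨i', j'⟩ hle hc
    obtain ⟨h1, h2⟩ := Prod.mk_le_mk.1 hle
    simp only [Finset.coe_filter, Finset.mem_product, Finset.mem_range, Set.mem_ofPred_eq] at hc ⊢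
    have := hf h1
    omega

theorem rowLen_ofRowFun (f : ℕ → ℕ) (hf : Antitone f) (h0 : ∃ N, f N = 0) (i : ℕ) :
    (ofRowFun f hf h0).rowLen i = f i := by
  have key : ∀ j, j < (ofRowFun f hf h0).rowLen i ↔ j < f i := by
    intro j
    rw [← mem_iff_lt_rowLen]
    change (i, j) ∈ (Finset.range (Nat.find h0) ×ˢ Finset.range (f 0)).filter
      (fun c => c.2 < f c.1) ↔ _
    simp only [Finset.mem_filter, Finset.mem_product, Finset.mem_range, and_iff_right_iff_imp]
    intro hj
    refine ⟨?_, hj.trans_le (hf (Nat.zero_le i))⟩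
    by_contra h
    have h1 := hf (not_lt.1 h)
    have h2 := Nat.find_spec h0
    omega
  exact le_antisymm (le_of_forall_lt fun j hj => (key j).1 hj)
    (le_of_forall_lt fun j hj => (key j).2 hj)

/-- Sequences lying between two consecutive rows of both `κ` and `ν`. -/
abbrev RowBox (κ ν : YoungDiagram) : Type :=
  {m : ℕ → ℕ // ∀ i, max (κ.rowLen (i + 1)) (ν.rowLen (i + 1)) ≤ m i ∧
    m i ≤ min (κ.rowLen i) (ν.rowLen i)}

theorem RowBox.eq_zero {κ ν : YoungDiagram} (m : RowBox κ ν) {N : ℕ} (hN : κ.rowLen N = 0) :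
    m.1 N = 0 := by
  have := (m.2 N).2
  omega

theorem RowBox.antitone {κ ν : YoungDiagram} (m : RowBox κ ν) : Antitone m.1 :=
  antitone_nat_of_succ_le fun i => by
    have := (m.2 (i + 1)).2
    have := (m.2 i).1
    omega

/-- Diagrams inside both `κ` and `ν` with horizontal strips as complements. -/
def lowerEquiv (κ ν : YoungDiagram) :
    {β : YoungDiagram // β.Interlaces κ ∧ β.Interlaces ν} ≃ RowBox κ ν where
  toFun β := ⟨β.1.rowLen, fun i => by
    have h1 := β.2.1 i
    have h2 := β.2.2 i
    omega⟩
  invFun m := ⟨ofRowFun m.1 m.antitone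
      (κ.exists_rowLen_eq_zero.imp fun N hN => m.eq_zero (hN N le_rfl)), by
    constructor <;> intro i <;> have := m.2 i <;> simp only [rowLen_ofRowFun] <;> omega⟩
  left_inv β := Subtype.ext (ext_rowLen fun i => by simp only [rowLen_ofRowFun])
  right_inv m := Subtype.ext (funext fun i => by simp only [rowLen_ofRowFun])

/-- The rows of the diagram whose first row has length `max (κ.rowLen 0) (ν.rowLen 0) + p.2` and
whose other rows are given by `p.1`. -/
def RowBox.cons {κ ν : YoungDiagram} (p : RowBox κ ν × ℕ) : ℕ → ℕ
  | 0 => max (κ.rowLen 0) (ν.rowLen 0) + p.2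
  | i + 1 => p.1.1 i

theorem RowBox.antitone_cons {κ ν : YoungDiagram} (p : RowBox κ ν × ℕ) :
    Antitone (RowBox.cons p) :=
  antitone_nat_of_succ_le fun i => by
    cases i with
    | zero =>
      have := (p.1.2 0).2
      simp only [RowBox.cons]
      omega
    | succ i => exact p.1.antitone (Nat.le_succ i)

/-- Diagrams containing both `κ` and `ν` with horizontal strips as complements. -/
def upperEquiv (κ ν : YoungDiagram) :
    {α : YoungDiagram // κ.Interlaces α ∧ ν.Interlaces α} ≃ RowBox κ ν × ℕ where
  toFun α := ⟨⟨fun i => α.1.rowLen (i + 1), fun i => by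
    have h1 := α.2.1 i
    have h2 := α.2.2 i
    have h3 := α.2.1 (i + 1)
    have h4 := α.2.2 (i + 1)
    simp only
    omega⟩, α.1.rowLen 0 - max (κ.rowLen 0) (ν.rowLen 0)⟩
  invFun p := ⟨ofRowFun _ (RowBox.antitone_cons p)
      (κ.exists_rowLen_eq_zero.elim fun N hN => ⟨N + 1, p.1.eq_zero (hN N le_rfl)⟩), by
    constructor <;> intro i <;> have := p.1.2 i <;> simp only [rowLen_ofRowFun] <;>
    · cases i with
      | zero => simp only [RowBox.cons]; omega
      | succ i =>
        have := p.1.2 i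
        simp only [RowBox.cons]
        omega⟩
  left_inv α := Subtype.ext (ext_rowLen fun i => by
    have h1 := α.2.1 0
    have h2 := α.2.2 0
    simp only [rowLen_ofRowFun]
    cases i with
    | zero => simp only [RowBox.cons]; omega
    | succ i => rfl)
  right_inv p := by
    refine Prod.ext (Subtype.ext (funext fun i => ?_)) ?_
    · simp only [rowLen_ofRowFun, RowBox.cons]
    · simp only [rowLen_ofRowFun, RowBox.cons]
      omega

theorem upperEquiv_symm_rowLen_zero {κ ν : YoungDiagram} (p : RowBox κ ν × ℕ) :
    ((upperEquiv κ ν).symm p).1.rowLen 0 = max (κ.rowLen 0) (ν.rowLen 0) + p.2 :=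
  rowLen_ofRowFun _ (RowBox.antitone_cons p) _ _

theorem upperEquiv_symm_rowLen_succ {κ ν : YoungDiagram} (p : RowBox κ ν × ℕ) (i : ℕ) :
    ((upperEquiv κ ν).symm p).1.rowLen (i + 1) = p.1.1 i :=
  rowLen_ofRowFun _ (RowBox.antitone_cons p) _ _

theorem lowerEquiv_symm_rowLen {κ ν : YoungDiagram} (m : RowBox κ ν) (i : ℕ) :
    ((lowerEquiv κ ν).symm m).1.rowLen i = m.1 i :=
  rowLen_ofRowFun _ m.antitone _ _

/-- Reflection of every coordinate of a box in its interval. -/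
def RowBox.reflect (κ ν : YoungDiagram) : RowBox κ ν ≃ RowBox κ ν where
  toFun m := ⟨fun i => max (κ.rowLen (i + 1)) (ν.rowLen (i + 1)) +
    min (κ.rowLen i) (ν.rowLen i) - m.1 i, fun i => by
    have := m.2 i
    simp only
    omega⟩
  invFun m := ⟨fun i => max (κ.rowLen (i + 1)) (ν.rowLen (i + 1)) +
    min (κ.rowLen i) (ν.rowLen i) - m.1 i, fun i => by
    have := m.2 i
    simp only
    omega⟩
  left_inv m := Subtype.ext (funext fun i => by
    have := m.2 i
    simp only
    omega)
  right_inv m := Subtype.ext (funext fun i => by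
    have := m.2 i
    simp only
    omega)

/-- The local rule of the growth diagrams. -/
theorem exists_growth_equiv (κ ν : YoungDiagram) :
    ∃ e : {β : YoungDiagram // β.Interlaces κ ∧ β.Interlaces ν} × ℕ ≃
        {α : YoungDiagram // κ.Interlaces α ∧ ν.Interlaces α},
      ∀ p, (e p).1.card + p.1.1.card = κ.card + ν.card + p.2 := by
  refine ⟨(((lowerEquiv κ ν).trans (RowBox.reflect κ ν)).prodCongr (Equiv.refl ℕ)).trans
    (upperEquiv κ ν).symm, ?_⟩
  rintro ⟨β, j⟩
  obtain ⟨N₁, h₁⟩ := κ.exists_rowLen_eq_zero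
  obtain ⟨N₂, h₂⟩ := ν.exists_rowLen_eq_zero
  obtain ⟨m, rfl⟩ := (lowerEquiv κ ν).symm.surjective β
  have hκ := h₁ (N₁ + N₂) (by omega)
  have hν := h₂ (N₁ + N₂) (by omega)
  generalize N₁ + N₂ = N at hκ hν
  simp only [Equiv.trans_apply, Equiv.prodCongr_apply, Prod.map_apply, Equiv.apply_symm_apply,
    Equiv.refl_apply]
  rw [card_eq_sum_rowLen _ (N := N + 1), card_eq_sum_rowLen ((lowerEquiv κ ν).symm m).1 (N := N),
    card_eq_sum_rowLen κ (N := N) hκ, card_eq_sum_rowLen ν (N := N) hν, Finset.sum_range_succ']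
  · simp only [upperEquiv_symm_rowLen_succ, upperEquiv_symm_rowLen_zero, lowerEquiv_symm_rowLen]
    have key : ∀ M, ∑ i ∈ Finset.range M, (RowBox.reflect κ ν m).1 i +
        max (κ.rowLen 0) (ν.rowLen 0) + ∑ i ∈ Finset.range M, m.1 i =
        ∑ i ∈ Finset.range M, κ.rowLen i + ∑ i ∈ Finset.range M, ν.rowLen i +
          max (κ.rowLen M) (ν.rowLen M) := by
      intro M
      induction M with
      | zero => simp
      | succ M ih =>
        simp only [Finset.sum_range_succ]
        have h1 : (RowBox.reflect κ ν m).1 M = max (κ.rowLen (M + 1)) (ν.rowLen (M + 1)) +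
          min (κ.rowLen M) (ν.rowLen M) - m.1 M := rfl
        have h2 := m.2 M
        omega
    have := key N
    omega
  · rw [lowerEquiv_symm_rowLen]
    exact m.eq_zero hκ
  · rw [upperEquiv_symm_rowLen_succ]
    exact RowBox.eq_zero _ hκ

/-- Given `a ≤ m ≤ b`, move `m` to the other side of `[a, b]` while exchanging, if `a + b` is odd,
the parity of its offset with that of the carry. -/
def carrySwap (a b : ℕ) (p : ℕ × ℕ) : ℕ × ℕ :=
  if (a + b) % 2 = 0 then (a + b - p.1, p.2)
  else (b - (2 * ((p.1 - a) / 2) + p.2 % 2), 2 * (p.2 / 2) + (p.1 - a) % 2)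

/-- The inverse of `carrySwap`. -/
def carryUnswap (a b : ℕ) (p : ℕ × ℕ) : ℕ × ℕ :=
  if (a + b) % 2 = 0 then (a + b - p.1, p.2)
  else (a + (2 * ((b - p.1) / 2) + p.2 % 2), 2 * (p.2 / 2) + (b - p.1) % 2)

section carry

variable {a b : ℕ} {p : ℕ × ℕ}

theorem carrySwap_mem (h : a ≤ p.1 ∧ p.1 ≤ b) :
    a ≤ (carrySwap a b p).1 ∧ (carrySwap a b p).1 ≤ b := by
  unfold carrySwap
  split_ifs <;> simp only <;> omega

theorem carryUnswap_mem (h : a ≤ p.1 ∧ p.1 ≤ b) :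
    a ≤ (carryUnswap a b p).1 ∧ (carryUnswap a b p).1 ≤ b := by
  unfold carryUnswap
  split_ifs <;> simp only <;> omega

theorem carryUnswap_carrySwap (h : a ≤ p.1 ∧ p.1 ≤ b) :
    carryUnswap a b (carrySwap a b p) = p := by
  unfold carrySwap carryUnswap
  split_ifs <;> ext <;> simp only <;> omega

theorem carrySwap_carryUnswap (h : a ≤ p.1 ∧ p.1 ≤ b) :
    carrySwap a b (carryUnswap a b p) = p := by
  unfold carrySwap carryUnswap
  split_ifs <;> ext <;> simp only <;> omega

theorem carrySwap_add (h : a ≤ p.1 ∧ p.1 ≤ b) :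
    p.1 + (carrySwap a b p).1 + p.2 = b + a + (carrySwap a b p).2 := by
  unfold carrySwap
  split_ifs <;> simp only <;> omega

theorem carrySwap_parity (h : a ≤ p.1 ∧ p.1 ≤ b) :
    p.1 % 2 + (b + p.2) % 2 = (carrySwap a b p).1 % 2 + (a + (carrySwap a b p).2) % 2 := by
  unfold carrySwap
  split_ifs <;> simp only <;> omega

end carry

theorem RowBox.bounds {κ : YoungDiagram} (m : RowBox κ κ) (i : ℕ) :
    κ.rowLen (i + 1) ≤ m.1 i ∧ m.1 i ≤ κ.rowLen i := by
  simpa using m.2 i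

/-- `carrySwap` applied in one coordinate of a box. -/
def RowBox.swapAt (κ : YoungDiagram) (i : ℕ) : RowBox κ κ × ℕ ≃ RowBox κ κ × ℕ where
  toFun p := (⟨Function.update p.1.1 i
      (carrySwap (κ.rowLen (i + 1)) (κ.rowLen i) (p.1.1 i, p.2)).1, fun k => by
    rcases eq_or_ne k i with rfl | hk
    · simpa using carrySwap_mem (p := (p.1.1 k, p.2)) (p.1.bounds k)
    · simpa [hk] using p.1.bounds k⟩,
    (carrySwap (κ.rowLen (i + 1)) (κ.rowLen i) (p.1.1 i, p.2)).2)
  invFun p := (⟨Function.update p.1.1 i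
      (carryUnswap (κ.rowLen (i + 1)) (κ.rowLen i) (p.1.1 i, p.2)).1, fun k => by
    rcases eq_or_ne k i with rfl | hk
    · simpa using carryUnswap_mem (p := (p.1.1 k, p.2)) (p.1.bounds k)
    · simpa [hk] using p.1.bounds k⟩,
    (carryUnswap (κ.rowLen (i + 1)) (κ.rowLen i) (p.1.1 i, p.2)).2)
  left_inv p := by
    have := carryUnswap_carrySwap (p := (p.1.1 i, p.2)) (p.1.bounds i)
    simp [this]
  right_inv p := by
    have := carrySwap_carryUnswap (p := (p.1.1 i, p.2)) (p.1.bounds i)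
    simp [this]

theorem RowBox.exists_carry_equiv (κ : YoungDiagram) (N : ℕ) :
    ∃ e : RowBox κ κ × ℕ ≃ RowBox κ κ × ℕ, ∀ p, (∀ k, N ≤ k → (e p).1.1 k = p.1.1 k) ∧
      ∑ k ∈ Finset.range N, p.1.1 k + ∑ k ∈ Finset.range N, (e p).1.1 k + p.2 + κ.rowLen 0 =
        2 * ∑ k ∈ Finset.range N, κ.rowLen k + κ.rowLen N + (e p).2 ∧
      ∑ k ∈ Finset.range N, p.1.1 k % 2 + (κ.rowLen 0 + p.2) % 2 =
        ∑ k ∈ Finset.range N, (e p).1.1 k % 2 + (κ.rowLen N + (e p).2) % 2 := by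
  induction N with
  | zero => exact ⟨Equiv.refl _, fun p => by simp; omega⟩
  | succ N ih =>
    obtain ⟨e, he⟩ := ih
    refine ⟨e.trans (RowBox.swapAt κ N), fun p => ?_⟩
    obtain ⟨h1, h2, h3⟩ := he p
    rw [Equiv.trans_apply]
    have hN := h1 N le_rfl
    generalize e p = q at h1 h2 h3 hN
    have ha := carrySwap_add (p := (q.1.1 N, q.2)) (q.1.bounds N)
    have hb := carrySwap_parity (p := (q.1.1 N, q.2)) (q.1.bounds N)
    have e1 : ∀ k, k ≠ N → (RowBox.swapAt κ N q).1.1 k = q.1.1 k := fun k hk =>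
      Function.update_of_ne hk _ _
    have e2 : (RowBox.swapAt κ N q).1.1 N =
        (carrySwap (κ.rowLen (N + 1)) (κ.rowLen N) (q.1.1 N, q.2)).1 :=
      Function.update_self _ _ _
    have e3 : (RowBox.swapAt κ N q).2 =
      (carrySwap (κ.rowLen (N + 1)) (κ.rowLen N) (q.1.1 N, q.2)).2 := rfl
    rw [← e2, ← e3] at ha hb
    have s1 : ∑ k ∈ Finset.range N, (RowBox.swapAt κ N q).1.1 k =
        ∑ k ∈ Finset.range N, q.1.1 k :=
      Finset.sum_congr rfl fun k hk => e1 k (Finset.mem_range.1 hk).ne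
    have s2 : ∑ k ∈ Finset.range N, (RowBox.swapAt κ N q).1.1 k % 2 =
        ∑ k ∈ Finset.range N, q.1.1 k % 2 :=
      Finset.sum_congr rfl fun k hk => by rw [e1 k (Finset.mem_range.1 hk).ne]
    refine ⟨fun k hk => ?_, ?_, ?_⟩
    · rw [e1 k (by omega), h1 k (by omega)]
    · simp only [Finset.sum_range_succ, s1]
      simp only at ha
      omega
    · simp only [Finset.sum_range_succ, s2]
      simp only at hb
      omega

/-- The local rule on the diagonal of the growth diagrams of the Burge correspondence. -/
theorem exists_diagonal_equiv (κ : YoungDiagram) :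
    ∃ e : {lam : YoungDiagram // κ.Interlaces lam} ≃ {ν : YoungDiagram // ν.Interlaces κ} × ℕ,
      ∀ lam, lam.1.card + (e lam).1.1.card = 2 * κ.card + (e lam).2 ∧
        oddRowsCount lam.1 = oddRowsCount (e lam).1.1 + (e lam).2 % 2 := by
  obtain ⟨N, hN⟩ := κ.exists_rowLen_eq_zero
  replace hN := hN N le_rfl
  obtain ⟨e, he⟩ := RowBox.exists_carry_equiv κ N
  refine ⟨(Equiv.subtypeEquivRight fun lam => (and_self_iff).symm).trans
    ((upperEquiv κ κ).trans (e.trans ((((lowerEquiv κ κ).symm).trans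
      (Equiv.subtypeEquivRight fun lam => and_self_iff)).prodCongr (Equiv.refl ℕ)))), ?_⟩
  rintro ⟨lam, hlam⟩
  obtain ⟨p, hp⟩ := (upperEquiv κ κ).symm.surjective ⟨lam, hlam, hlam⟩
  have hl : lam = ((upperEquiv κ κ).symm p).1 := by rw [hp]
  have hp' : upperEquiv κ κ ⟨lam, hlam, hlam⟩ = p := by rw [← hp, Equiv.apply_symm_apply]
  obtain ⟨-, h2, h3⟩ := he p
  simp only [Equiv.trans_apply, Equiv.prodCongr_apply,
    Equiv.coe_trans]
  have hs : (Equiv.subtypeEquivRight (p := fun lam => κ.Interlaces lam)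
    (fun lam => (and_self_iff (a := κ.Interlaces lam)).symm)) ⟨lam, hlam⟩ = ⟨lam, hlam, hlam⟩ := rfl
  rw [hs, hp', hl]
  simp only [Prod.map_fst, Prod.map_snd, Function.comp_apply, Equiv.refl_apply,
    Equiv.subtypeEquivRight_apply_coe]
  generalize e p = q at h2 h3
  have z1 : ((upperEquiv κ κ).symm p).1.rowLen (N + 1) = 0 := by
    rw [upperEquiv_symm_rowLen_succ]
    exact RowBox.eq_zero _ hN
  have z2 : ((lowerEquiv κ κ).symm q.1).1.rowLen N = 0 := by
    rw [lowerEquiv_symm_rowLen]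
    exact RowBox.eq_zero _ hN
  rw [card_eq_sum_rowLen _ z1, card_eq_sum_rowLen _ z2, card_eq_sum_rowLen _ hN,
    oddRowsCount_eq_sum _ z1, oddRowsCount_eq_sum _ z2]
  simp only [Finset.sum_range_succ', upperEquiv_symm_rowLen_succ, upperEquiv_symm_rowLen_zero,
    lowerEquiv_symm_rowLen, max_self]
  omega

end YoungDiagram

section counting

open scoped ENNReal Classical

namespace YoungDiagram

theorem Interlaces.le {κ lam : YoungDiagram} (h : κ.Interlaces lam) : κ ≤ lam := by
  rintro ⟨i, j⟩ hc
  exact mem_iff_lt_rowLen.2 ((mem_iff_lt_rowLen.1 hc).trans_le (h i).1)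

theorem Interlaces.card_le {κ lam : YoungDiagram} (h : κ.Interlaces lam) : κ.card ≤ lam.card :=
  Finset.card_le_card (cells_subset_iff.2 h.le)

theorem interlaces_iff {κ lam : YoungDiagram} :
    κ.Interlaces lam ↔ κ ≤ lam ∧ ∀ i j, (i + 1, j) ∈ lam → (i, j) ∈ κ := by
  refine ⟨fun h => ⟨h.le, fun i j hc => ?_⟩, fun h i => ⟨?_, ?_⟩⟩
  · exact mem_iff_lt_rowLen.2 ((mem_iff_lt_rowLen.1 hc).trans_le (h i).2)
  · exact le_of_forall_lt fun j hj => mem_iff_lt_rowLen.1 (h.1 (mem_iff_lt_rowLen.2 hj))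
  · exact le_of_forall_lt fun j hj => mem_iff_lt_rowLen.1 (h.2 i j (mem_iff_lt_rowLen.2 hj))

/-- The indicator of `lam / κ` being a horizontal strip of size `s`. -/
noncomputable def stripWeight (κ lam : YoungDiagram) (s : ℕ) : ℝ≥0∞ :=
  if κ.Interlaces lam ∧ lam.card = κ.card + s then 1 else 0

theorem tsum_ite_and {ι : Type*} (p q : ι → Prop)
    [DecidablePred fun a => p a ∧ q a] [DecidablePred q] (g : ι → ℝ≥0∞) :
    ∑' a, (if p a ∧ q a then g a else 0) = ∑' a : {a // p a}, if q a then g a else 0 := by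
  rw [show (∑' a : {a // p a}, if q a then g a else 0) =
    ∑' a, Set.indicator {a | p a} (fun a => if q a then g a else 0) a from
    tsum_subtype {a | p a} (fun a => if q a then g a else 0)]
  refine tsum_congr fun a => ?_
  by_cases hp : p a <;> simp [hp, Set.indicator]

theorem tsum_stripWeight_comm (κ ν : YoungDiagram) (s r : ℕ) :
    ∑' α, stripWeight κ α s * stripWeight ν α r =
      ∑' j, if j ≤ s ∧ j ≤ r then
        ∑' β, stripWeight β κ (r - j) * stripWeight β ν (s - j) else 0 := by
  obtain ⟨e, he⟩ := exists_growth_equiv κ ν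
  have h1 : ∀ α, stripWeight κ α s * stripWeight ν α r =
      if (κ.Interlaces α ∧ ν.Interlaces α) ∧ (α.card = κ.card + s ∧ α.card = ν.card + r)
        then 1 else 0 := by
    intro α
    unfold stripWeight
    split_ifs <;> simp <;> tauto
  simp_rw [h1]
  rw [tsum_ite_and (fun α => κ.Interlaces α ∧ ν.Interlaces α)
    (fun α => α.card = κ.card + s ∧ α.card = ν.card + r) (fun _ => 1), ← e.tsum_eq,
    ENNReal.tsum_prod', ENNReal.tsum_comm]
  refine tsum_congr fun j => ?_
  have h2 : ∀ β : {β : YoungDiagram // β.Interlaces κ ∧ β.Interlaces ν},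
      ((e (β, j)).1.card = κ.card + s ∧ (e (β, j)).1.card = ν.card + r) ↔
      ((j ≤ s ∧ j ≤ r) ∧ κ.card = β.1.card + (r - j) ∧ ν.card = β.1.card + (s - j)) := by
    intro β
    have h := he (β, j)
    have := β.2.1.card_le
    have := β.2.2.card_le
    simp only at h
    omega
  simp_rw [h2]
  by_cases hj : j ≤ s ∧ j ≤ r
  · simp only [hj, and_self, true_and, if_true]
    rw [← tsum_ite_and (fun β : YoungDiagram => β.Interlaces κ ∧ β.Interlaces ν)
      (fun β => κ.card = β.card + (r - j) ∧ ν.card = β.card + (s - j)) (fun _ => 1)]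
    refine tsum_congr fun β => ?_
    unfold stripWeight
    split_ifs <;> simp <;> tauto
  · simp [hj]

theorem tsum_stripWeight_diagonal (κ : YoungDiagram) (s : ℕ) (f : ℕ → ℝ≥0∞) :
    ∑' lam, f (oddRowsCount lam) * stripWeight κ lam s =
      ∑' j, if j ≤ s then
        ∑' ν, f (oddRowsCount ν + j % 2) * stripWeight ν κ (s - j) else 0 := by
  obtain ⟨e, he⟩ := exists_diagonal_equiv κ
  simp only [stripWeight, mul_ite, mul_one, mul_zero]
  rw [tsum_ite_and (fun lam => κ.Interlaces lam) (fun lam => lam.card = κ.card + s)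
    (fun lam => f (oddRowsCount lam)), ← e.symm.tsum_eq, ENNReal.tsum_prod', ENNReal.tsum_comm]
  refine tsum_congr fun j => ?_
  have h2 : ∀ ν : {ν : YoungDiagram // ν.Interlaces κ},
      ((e.symm (ν, j)).1.card = κ.card + s ↔ (j ≤ s ∧ κ.card = ν.1.card + (s - j))) ∧
      oddRowsCount (e.symm (ν, j)).1 = oddRowsCount ν.1 + j % 2 := by
    intro ν
    obtain ⟨h, h'⟩ := he (e.symm (ν, j))
    rw [Equiv.apply_symm_apply] at h h'
    have := ν.2.card_le
    simp only at h h'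
    refine ⟨?_, h'⟩
    omega
  simp only [fun ν => (h2 ν).1, fun ν => (h2 ν).2]
  by_cases hj : j ≤ s
  · simp only [hj, true_and, if_true]
    rw [← tsum_ite_and (fun ν => ν.Interlaces κ) (fun ν => κ.card = ν.card + (s - j))
      (fun ν => f (oddRowsCount ν + j % 2))]
  · simp [hj]

/-- The number of chains of horizontal strips from `⊥` to `lam` of prescribed sizes. -/
noncomputable def chainCount : (n : ℕ) → (Fin n → ℕ) → YoungDiagram → ℝ≥0∞
  | 0, _, lam => if lam = ⊥ then 1 else 0
  | n + 1, μ, lam => ∑' κ, stripWeight κ lam (μ (Fin.last n)) * chainCount n (Fin.init μ) κ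

theorem rowLen_bot (i : ℕ) : (⊥ : YoungDiagram).rowLen i = 0 := by
  by_contra h
  exact notMem_bot _ (mem_iff_lt_rowLen.2 (Nat.pos_of_ne_zero h))

theorem card_bot : (⊥ : YoungDiagram).card = 0 := rfl

theorem stripWeight_bot (ν : YoungDiagram) (r : ℕ) :
    stripWeight ν ⊥ r = if r = 0 then (if ν = ⊥ then 1 else 0) else 0 := by
  unfold stripWeight
  have : (ν.Interlaces ⊥ ∧ (⊥ : YoungDiagram).card = ν.card + r) ↔ (r = 0 ∧ ν = ⊥) := by
    constructor
    · rintro ⟨h1, h2⟩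
      rw [card_bot] at h2
      exact ⟨by omega, le_bot_iff.1 h1.le⟩
    · rintro ⟨rfl, rfl⟩
      exact ⟨fun i => by simp [rowLen_bot], rfl⟩
  simp only [this, ite_and]

theorem tsum_stripWeight_mul_chainCount (n : ℕ) (μ : Fin n → ℕ) (ν : YoungDiagram) (r : ℕ) :
    ∑' κ, stripWeight ν κ r * chainCount n μ κ =
      ∑' a : Fin n → ℕ, if a ≤ μ ∧ ∑ i, a i = r then chainCount n (μ - a) ν else 0 := by
  induction n generalizing ν r with
  | zero =>
    rw [tsum_eq_single (⊥ : YoungDiagram), tsum_eq_single (fun i => i.elim0)]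
    · rw [stripWeight_bot]
      simp [chainCount, eq_comm]
    · intro a ha
      exact absurd (Subsingleton.elim _ _) ha
    · intro κ hκ
      simp [chainCount, hκ]
  | succ n ih =>
    set s := μ (Fin.last n) with hs
    calc ∑' α, stripWeight ν α r * chainCount (n + 1) μ α
        = ∑' κ, chainCount n (Fin.init μ) κ * ∑' α, stripWeight κ α s * stripWeight ν α r := by
          simp only [chainCount, ← ENNReal.tsum_mul_left]
          rw [ENNReal.tsum_comm]
          refine tsum_congr fun κ => tsum_congr fun α => ?_
          ring
      _ = ∑' j, if j ≤ s ∧ j ≤ r then ∑' β, stripWeight β ν (s - j) *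
            ∑' κ, stripWeight β κ (r - j) * chainCount n (Fin.init μ) κ else 0 := by
          simp only [tsum_stripWeight_comm, ← ENNReal.tsum_mul_left]
          rw [ENNReal.tsum_comm]
          refine tsum_congr fun j => ?_
          split_ifs
          · simp only [← ENNReal.tsum_mul_left]
            rw [ENNReal.tsum_comm]
            refine tsum_congr fun β => tsum_congr fun κ => ?_
            ring
          · simp
      _ = ∑' j, ∑' a : Fin n → ℕ, if (j ≤ s ∧ a ≤ Fin.init μ) ∧ ∑ i, a i + j = r then
            ∑' β, stripWeight β ν (s - j) * chainCount n (Fin.init μ - a) β else 0 := by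
          refine tsum_congr fun j => ?_
          simp only [ih]
          split_ifs with hj
          · simp only [← ENNReal.tsum_mul_left]
            rw [ENNReal.tsum_comm]
            refine tsum_congr fun a => ?_
            have : (a ≤ Fin.init μ ∧ ∑ i, a i = r - j) ↔
                ((j ≤ s ∧ a ≤ Fin.init μ) ∧ ∑ i, a i + j = r) := by
              have := hj.1
              constructor
              · rintro ⟨h1, h2⟩
                exact ⟨⟨this, h1⟩, by omega⟩
              · rintro ⟨h1, h2⟩
                exact ⟨h1.2, by omega⟩
            simp only [this]
            split_ifs <;> simp
          · symm
            rw [ENNReal.tsum_eq_zero]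
            intro a
            rw [if_neg]
            rintro ⟨h1, h2⟩
            exact hj ⟨h1.1, by omega⟩
      _ = _ := by
          rw [← (Fin.snocEquiv fun _ => ℕ).tsum_eq, ENNReal.tsum_prod']
          refine tsum_congr fun j => tsum_congr fun a => ?_
          have h1 : (Fin.snocEquiv (fun _ => ℕ) (j, a) ≤ μ) ↔ (j ≤ s ∧ a ≤ Fin.init μ) := by
            simp only [Pi.le_def, Fin.forall_fin_succ', Fin.snocEquiv_apply, Fin.snoc_castSucc,
              Fin.snoc_last, Fin.init]
            tauto
          have h2 : ∑ i, Fin.snocEquiv (fun _ => ℕ) (j, a) i = ∑ i, a i + j := by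
            rw [Fin.sum_univ_castSucc]
            simp
          have h3 : Fin.init (μ - Fin.snocEquiv (fun _ => ℕ) (j, a)) = Fin.init μ - a := by
            funext i
            simp [Fin.init]
          rw [h1, h2]
          simp only [chainCount, h3, Pi.sub_apply, Fin.snocEquiv_apply, Fin.snoc_last, ← hs]
          split_ifs <;> rfl

/-- The sum of `f (oddRowsCount lam)` over all chains of horizontal strips of sizes `μ`, where
`lam` is the last diagram of the chain. -/
noncomputable def chainSum (n : ℕ) (μ : Fin n → ℕ) (f : ℕ → ℝ≥0∞) : ℝ≥0∞ :=
  ∑' lam, f (oddRowsCount lam) * chainCount n μ lam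

theorem oddRowsCount_bot : oddRowsCount ⊥ = 0 := by
  rw [oddRowsCount_eq_sum ⊥ (N := 0) (rowLen_bot 0)]
  rfl

theorem chainSum_zero (μ : Fin 0 → ℕ) (f : ℕ → ℝ≥0∞) : chainSum 0 μ f = f 0 := by
  unfold chainSum
  rw [tsum_eq_single (⊥ : YoungDiagram)]
  · simp [chainCount, oddRowsCount_bot]
  · intro κ hκ
    simp [chainCount, hκ]

theorem chainSum_succ (n : ℕ) (μ : Fin (n + 1) → ℕ) (f : ℕ → ℝ≥0∞) :
    chainSum (n + 1) μ f = ∑' j, ∑' a : Fin n → ℕ,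
      if a ≤ Fin.init μ ∧ ∑ i, a i + j = μ (Fin.last n) then
        chainSum n (Fin.init μ - a) (fun q => f (q + j % 2)) else 0 := by
  set s := μ (Fin.last n) with hs
  calc chainSum (n + 1) μ f
      = ∑' κ, chainCount n (Fin.init μ) κ *
          ∑' lam, f (oddRowsCount lam) * stripWeight κ lam s := by
        simp only [chainSum, chainCount, ← ENNReal.tsum_mul_left]
        rw [ENNReal.tsum_comm]
        refine tsum_congr fun κ => tsum_congr fun α => ?_
        ring
    _ = ∑' j, if j ≤ s then ∑' ν, f (oddRowsCount ν + j % 2) *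
          ∑' κ, stripWeight ν κ (s - j) * chainCount n (Fin.init μ) κ else 0 := by
        simp only [tsum_stripWeight_diagonal, ← ENNReal.tsum_mul_left]
        rw [ENNReal.tsum_comm]
        refine tsum_congr fun j => ?_
        split_ifs
        · simp only [← ENNReal.tsum_mul_left]
          rw [ENNReal.tsum_comm]
          refine tsum_congr fun β => tsum_congr fun κ => ?_
          ring
        · simp
    _ = _ := by
        refine tsum_congr fun j => ?_
        simp only [tsum_stripWeight_mul_chainCount, chainSum]
        split_ifs with hj
        · simp only [← ENNReal.tsum_mul_left]
          rw [ENNReal.tsum_comm]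
          refine tsum_congr fun a => ?_
          have : ∑ i, a i = s - j ↔ ∑ i, a i + j = s := by omega
          simp only [this]
          split_ifs <;> simp
        · symm
          rw [ENNReal.tsum_eq_zero]
          intro a
          rw [if_neg]
          rintro ⟨h1, h2⟩
          omega

theorem card_eq_of_chainCount_ne_zero {n : ℕ} {μ : Fin n → ℕ} {lam : YoungDiagram}
    (h : chainCount n μ lam ≠ 0) : lam.card = ∑ i, μ i := by
  induction n generalizing lam with
  | zero =>
    have : lam = ⊥ := by
      by_contra h'
      simp [chainCount, h'] at h
    simp [this, card_bot]
  | succ n ih =>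
    rw [chainCount, Ne, ENNReal.tsum_eq_zero, not_forall] at h
    obtain ⟨κ, hκ⟩ := h
    have h1 := left_ne_zero_of_mul hκ
    have h2 := ih (right_ne_zero_of_mul hκ)
    unfold stripWeight at h1
    have h3 : κ.Interlaces lam ∧ lam.card = κ.card + μ (Fin.last n) := by
      by_contra h'
      simp [h'] at h1
    rw [h3.2, h2, Fin.sum_univ_castSucc]
    rfl

end YoungDiagram

/-- A symmetric matrix is determined by its last diagonal entry, the rest of its last column and
its leading principal submatrix. -/
def symmMatrixEquiv (n : ℕ) : {A : Matrix (Fin (n + 1)) (Fin (n + 1)) ℕ // A.IsSymm} ≃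
    ℕ × (Fin n → ℕ) × {A : Matrix (Fin n) (Fin n) ℕ // A.IsSymm} where
  toFun A := (A.1 (Fin.last n) (Fin.last n), fun i => A.1 i.castSucc (Fin.last n),
    ⟨A.1.submatrix Fin.castSucc Fin.castSucc, A.2.submatrix _⟩)
  invFun p := ⟨Matrix.of fun i j => Fin.lastCases (motive := fun _ => ℕ)
      (Fin.lastCases (motive := fun _ => ℕ) p.1 p.2.1 j)
      (fun i' => Fin.lastCases (motive := fun _ => ℕ) (p.2.1 i') (p.2.2.1 i') j) i, by
    refine Matrix.IsSymm.ext fun i j => ?_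
    refine Fin.lastCases ?_ (fun i' => ?_) i <;> refine Fin.lastCases ?_ (fun j' => ?_) j <;>
      simp [p.2.2.2.apply]⟩
  left_inv A := by
    refine Subtype.ext (Matrix.ext fun i j => ?_)
    refine Fin.lastCases ?_ (fun i' => ?_) i <;> refine Fin.lastCases ?_ (fun j' => ?_) j <;>
      simp [A.2.apply]
  right_inv p := by
    refine Prod.ext (by simp) (Prod.ext (by simp) (Subtype.ext (Matrix.ext fun i j => ?_)))
    simp 

/-- The sum of `f k` over all symmetric matrices with row sums `μ`, where `k` is the number of odd
diagonal entries. -/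
noncomputable def symmMatrixSum (n : ℕ) (μ : Fin n → ℕ) (f : ℕ → ℝ≥0∞) : ℝ≥0∞ :=
  ∑' A : {A : Matrix (Fin n) (Fin n) ℕ // A.IsSymm}, if ∀ i, ∑ j, A.1 i j = μ i then
    f (Finset.univ.filter fun i => A.1 i i % 2 = 1).card else 0

theorem symmMatrixSum_succ (n : ℕ) (μ : Fin (n + 1) → ℕ) (f : ℕ → ℝ≥0∞) :
    symmMatrixSum (n + 1) μ f = ∑' j, ∑' a : Fin n → ℕ,
      if a ≤ Fin.init μ ∧ ∑ i, a i + j = μ (Fin.last n) then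
        symmMatrixSum n (Fin.init μ - a) (fun q => f (q + j % 2)) else 0 := by
  unfold symmMatrixSum
  rw [← (symmMatrixEquiv n).symm.tsum_eq, ENNReal.tsum_prod']
  refine tsum_congr fun j => ?_
  rw [ENNReal.tsum_prod']
  refine tsum_congr fun a => ?_
  have h1 : ∀ A : {A : Matrix (Fin n) (Fin n) ℕ // A.IsSymm},
      (∀ i, ∑ k, ((symmMatrixEquiv n).symm (j, a, A)).1 i k = μ i) ↔
      ((a ≤ Fin.init μ ∧ ∑ i, a i + j = μ (Fin.last n)) ∧
        ∀ i, ∑ k, A.1 i k = (Fin.init μ - a) i) := by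
    intro A
    simp only [symmMatrixEquiv, Equiv.coe_fn_symm_mk, Matrix.of_apply, Fin.forall_fin_succ',
      Fin.sum_univ_castSucc, Fin.lastCases_castSucc, Fin.lastCases_last, Pi.le_def, Pi.sub_apply, Fin.init]
    constructor
    · rintro ⟨h1, h2⟩
      exact ⟨⟨fun i => by have := h1 i; omega, h2⟩, fun i => by have := h1 i; omega⟩
    · rintro ⟨⟨h1, h2⟩, h3⟩
      exact ⟨fun i => by have := h1 i; have := h3 i; omega, h2⟩
  have h2 : ∀ A : {A : Matrix (Fin n) (Fin n) ℕ // A.IsSymm},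
      (Finset.univ.filter fun i => ((symmMatrixEquiv n).symm (j, a, A)).1 i i % 2 = 1).card =
      (Finset.univ.filter fun i => A.1 i i % 2 = 1).card + j % 2 := by
    intro A
    rw [Finset.card_filter, Fin.sum_univ_castSucc, Finset.card_filter]
    simp only [symmMatrixEquiv, Equiv.coe_fn_symm_mk, Matrix.of_apply, Fin.lastCases_castSucc,
      Fin.lastCases_last]
    rcases Nat.mod_two_eq_zero_or_one j with h | h <;> simp [h]
  simp only [h1, h2]
  split_ifs with h
  · simp [h]
  · simp [h]

theorem symmMatrixSum_eq_chainSum (n : ℕ) (μ : Fin n → ℕ) (f : ℕ → ℝ≥0∞) :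
    symmMatrixSum n μ f = YoungDiagram.chainSum n μ f := by
  induction n generalizing f with
  | zero =>
    rw [YoungDiagram.chainSum_zero, symmMatrixSum,
      tsum_eq_single ⟨0, Matrix.isSymm_zero⟩ fun A hA =>
        absurd (Subtype.ext (Subsingleton.elim _ _)) hA]
    simp
  | succ n ih =>
    rw [symmMatrixSum_succ, YoungDiagram.chainSum_succ]
    simp only [ih]

namespace SemistandardYoungTableau

variable {lam κ : YoungDiagram}

/-- The entry `j` occurs `μ j` times in `T`, and no entry `≥ n` occurs. -/
def HasWeight (T : SemistandardYoungTableau lam) {n : ℕ} (μ : Fin n → ℕ) : Prop :=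
  ∀ j : ℕ, ssytWeight T j = if h : j < n then μ ⟨j, h⟩ else 0

theorem HasWeight.lt {T : SemistandardYoungTableau lam} {n : ℕ} {μ : Fin n → ℕ}
    (hT : T.HasWeight μ) {i j : ℕ} (hc : (i, j) ∈ lam) : T i j < n := by
  by_contra h
  have h1 := hT (T i j)
  rw [dif_neg h, ssytWeight, Finset.card_eq_zero] at h1
  have h2 : (i, j) ∈ lam.cells.filter fun c => T c.1 c.2 = T i j := by simpa using hc
  simp [h1] at h2

/-- The diagram formed by the cells with entries smaller than `n`. -/
def shapeLT (T : SemistandardYoungTableau lam) (n : ℕ) : YoungDiagram where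
  cells := lam.cells.filter fun c => T c.1 c.2 < n
  isLowerSet := by
    rintro ⟨i, j⟩ ⟨i', j'⟩ hle hc
    obtain ⟨h1, h2⟩ := Prod.mk_le_mk.1 hle
    simp only [Finset.coe_filter, YoungDiagram.mem_cells, Set.mem_ofPred_eq] at hc ⊢
    exact ⟨lam.up_left_mem h1 h2 hc.1, ((T.row_weak_of_le h2 (lam.up_left_mem h1 le_rfl hc.1)).trans
      (T.col_weak h1 hc.1)).trans_lt hc.2⟩

theorem mem_shapeLT {T : SemistandardYoungTableau lam} {n i j : ℕ} :
    (i, j) ∈ T.shapeLT n ↔ (i, j) ∈ lam ∧ T i j < n := by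
  change (i, j) ∈ lam.cells.filter (fun c => T c.1 c.2 < n) ↔ _
  simp

/-- The part of a tableau inside a smaller diagram. -/
def restrict (T : SemistandardYoungTableau lam) (h : κ ≤ lam) : SemistandardYoungTableau κ where
  entry i j := if (i, j) ∈ κ then T i j else 0
  row_weak' {i j1 j2} hj hc := by
    rw [if_pos hc, if_pos (κ.up_left_mem le_rfl hj.le hc)]
    exact T.row_weak hj (h hc)
  col_strict' {i1 i2 j} hi hc := by
    rw [if_pos hc, if_pos (κ.up_left_mem hi.le le_rfl hc)]
    exact T.col_strict hi (h hc)
  zeros' hc := if_neg hc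

theorem restrict_apply (T : SemistandardYoungTableau lam) (h : κ ≤ lam) (i j : ℕ) :
    T.restrict h i j = if (i, j) ∈ κ then T i j else 0 := rfl

/-- The extension of a tableau with entries smaller than `n` by a horizontal strip filled
with `n`. -/
def extend (T : SemistandardYoungTableau κ) (h : κ.Interlaces lam) (n : ℕ)
    (hT : ∀ i j, (i, j) ∈ κ → T i j < n) : SemistandardYoungTableau lam where
  entry i j := if (i, j) ∈ κ then T i j else if (i, j) ∈ lam then n else 0
  row_weak' {i j1 j2} hj hc := by
    by_cases h2 : (i, j2) ∈ κ
    · rw [if_pos h2, if_pos (κ.up_left_mem le_rfl hj.le h2)]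
      exact T.row_weak hj h2
    · rw [if_neg h2, if_pos hc, if_pos (lam.up_left_mem le_rfl hj.le hc)]
      split_ifs with h1
      · exact (hT _ _ h1).le
      · exact le_rfl
  col_strict' {i1 i2 j} hi hc := by
    by_cases h2 : (i2, j) ∈ κ
    · rw [if_pos h2, if_pos (κ.up_left_mem hi.le le_rfl h2)]
      exact T.col_strict hi h2
    · have h1 : (i1, j) ∈ κ := (YoungDiagram.interlaces_iff.1 h).2 i1 j
        (lam.up_left_mem (Nat.succ_le_of_lt hi) le_rfl hc)
      rw [if_neg h2, if_pos hc, if_pos h1]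
      exact hT _ _ h1
  zeros' {i j} hc := by
    rw [if_neg fun h' => hc (h.le h'), if_neg hc]

theorem extend_apply (T : SemistandardYoungTableau κ) (h : κ.Interlaces lam) (n : ℕ)
    (hT : ∀ i j, (i, j) ∈ κ → T i j < n) (i j : ℕ) :
    T.extend h n hT i j = if (i, j) ∈ κ then T i j else if (i, j) ∈ lam then n else 0 := rfl

theorem ssytWeight_of_agree {T : SemistandardYoungTableau lam} {T' : SemistandardYoungTableau κ}
    {n : ℕ} (h : κ ≤ lam) (h1 : ∀ i j, (i, j) ∈ κ → T i j = T' i j)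
    (h2 : ∀ i j, (i, j) ∈ lam → (i, j) ∉ κ → T i j = n) (k : ℕ) :
    ssytWeight T k = ssytWeight T' k + if k = n then lam.card - κ.card else 0 := by
  have hsub := YoungDiagram.cells_subset_iff.2 h
  unfold ssytWeight
  rw [← Finset.sdiff_union_of_subset hsub, Finset.filter_union,
    Finset.card_union_of_disjoint (Finset.disjoint_filter_filter Finset.sdiff_disjoint), add_comm]
  congr 1
  · congr 1
    refine Finset.filter_congr ?_
    rintro ⟨i, j⟩ hc
    rw [h1 i j hc]
  · have : ((lam.cells \ κ.cells).filter fun c => T c.1 c.2 = k) =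
        (lam.cells \ κ.cells).filter fun _ => k = n := by
      refine Finset.filter_congr ?_
      rintro ⟨i, j⟩ hc
      rw [Finset.mem_sdiff] at hc
      rw [h2 i j hc.1 hc.2, eq_comm]
    rw [this]
    split_ifs with hk
    · rw [Finset.filter_true_of_mem fun _ _ => hk, Finset.card_sdiff_of_subset hsub]
    · rw [Finset.filter_false_of_mem fun _ _ => hk, Finset.card_empty]

theorem hasWeight_of_agree {T : SemistandardYoungTableau lam} {T' : SemistandardYoungTableau κ}
    {n : ℕ} {μ : Fin (n + 1) → ℕ} (h : κ ≤ lam) (h1 : ∀ i j, (i, j) ∈ κ → T i j = T' i j)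
    (h2 : ∀ i j, (i, j) ∈ lam → (i, j) ∉ κ → T i j = n) (h3 : ∀ i j, (i, j) ∈ κ → T' i j < n) :
    T.HasWeight μ ↔ T'.HasWeight (Fin.init μ) ∧ lam.card = κ.card + μ (Fin.last n) := by
  have hcard : κ.card ≤ lam.card := Finset.card_le_card (YoungDiagram.cells_subset_iff.2 h)
  have hn : ssytWeight T' n = 0 := by
    rw [ssytWeight, Finset.card_eq_zero, Finset.filter_eq_empty_iff]
    rintro ⟨i, j⟩ hc
    exact (h3 i j hc).ne
  unfold HasWeight
  simp only [ssytWeight_of_agree h h1 h2]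
  constructor
  · intro H
    refine ⟨fun j => ?_, ?_⟩
    · have Hj := H j
      rcases lt_trichotomy j n with hj | rfl | hj
      · rw [dif_pos (by omega), if_neg hj.ne] at Hj
        rw [dif_pos hj]
        exact Hj
      · rw [hn, dif_neg (lt_irrefl _)]
      · rw [dif_neg (by omega), if_neg hj.ne'] at Hj
        rw [dif_neg (by omega)]
        exact Hj
    · have Hn := H n
      rw [hn, if_pos rfl, dif_pos (Nat.lt_succ_self n)] at Hn
      change _ = μ (Fin.last n) at Hn
      omega
  · rintro ⟨H, hc⟩ j
    have Hj := H j
    rcases lt_trichotomy j n with hj | rfl | hj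
    · rw [dif_pos hj] at Hj
      rw [dif_pos (by omega), if_neg hj.ne]
      exact Hj
    · rw [hn, if_pos rfl, dif_pos (Nat.lt_succ_self j)]
      change _ = μ (Fin.last j)
      omega
    · rw [dif_neg (by omega)] at Hj
      rw [dif_neg (by omega), if_neg hj.ne']
      exact Hj

theorem shapeLT_interlaces (T : SemistandardYoungTableau lam) {n : ℕ} {μ : Fin (n + 1) → ℕ}
    (hT : T.HasWeight μ) : (T.shapeLT n).Interlaces lam := by
  rw [YoungDiagram.interlaces_iff]
  refine ⟨fun ⟨i, j⟩ hc => (mem_shapeLT.1 hc).1, fun i j hc => ?_⟩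
  have h1 := hT.lt hc
  have h2 : T i j < T (i + 1) j := T.col_strict (Nat.lt_succ_self i) hc
  exact mem_shapeLT.2 ⟨lam.up_left_mem (Nat.le_succ i) le_rfl hc, by omega⟩

theorem restrict_shapeLT_hasWeight (T : SemistandardYoungTableau lam) {n : ℕ}
    {μ : Fin (n + 1) → ℕ} (hT : T.HasWeight μ) (h : T.shapeLT n ≤ lam) :
    (T.restrict h).HasWeight (Fin.init μ) ∧ lam.card = (T.shapeLT n).card + μ (Fin.last n) := by
  refine (hasWeight_of_agree h (fun i j hc => ?_) (fun i j hc hc' => ?_)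
    (fun i j hc => ?_)).1 hT
  · rw [restrict_apply, if_pos hc]
  · rw [mem_shapeLT] at hc'
    have := hT.lt hc
    by_contra hne
    exact hc' ⟨hc, by omega⟩
  · rw [restrict_apply, if_pos hc]
    exact (mem_shapeLT.1 hc).2

theorem extend_hasWeight (T : SemistandardYoungTableau κ) {n : ℕ} {μ : Fin (n + 1) → ℕ}
    (hT : T.HasWeight (Fin.init μ)) (h : κ.Interlaces lam)
    (hc : lam.card = κ.card + μ (Fin.last n)) :
    (T.extend h n fun _ _ => hT.lt).HasWeight μ := by
  refine (hasWeight_of_agree h.le (fun i j hc => ?_) (fun i j hc hc' => ?_)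
    (fun i j hc => hT.lt hc)).2 ⟨hT, hc⟩
  · rw [extend_apply, if_pos hc]
  · rw [extend_apply, if_neg hc', if_pos hc]

theorem shapeLT_extend (T : SemistandardYoungTableau κ) {n : ℕ} (h : κ.Interlaces lam)
    (hT : ∀ i j, (i, j) ∈ κ → T i j < n) : (T.extend h n hT).shapeLT n = κ := by
  ext ⟨i, j⟩
  rw [YoungDiagram.mem_cells, YoungDiagram.mem_cells, mem_shapeLT, extend_apply]
  by_cases hc : (i, j) ∈ κ
  · simp [hc, h.le hc, hT i j hc]
  · by_cases hc' : (i, j) ∈ lam <;> simp [hc, hc']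

/-- Tableaux of weight `μ` whose entries smaller than `n` occupy `κ` correspond to tableaux of
shape `κ`. -/
def extendEquiv {n : ℕ} {μ : Fin (n + 1) → ℕ} (h : κ.Interlaces lam)
    (hcard : lam.card = κ.card + μ (Fin.last n)) :
    {T : SemistandardYoungTableau κ // T.HasWeight (Fin.init μ)} ≃
      {T : {T : SemistandardYoungTableau lam // T.HasWeight μ} // T.1.shapeLT n = κ} where
  toFun T := ⟨⟨T.1.extend h n fun _ _ => T.2.lt, T.1.extend_hasWeight T.2 h hcard⟩,
    T.1.shapeLT_extend h fun _ _ => T.2.lt⟩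
  invFun T := ⟨T.1.1.restrict h.le, by
    obtain ⟨⟨T, hT⟩, rfl⟩ := T
    exact (T.restrict_shapeLT_hasWeight hT h.le).1⟩
  left_inv T := Subtype.ext <| SemistandardYoungTableau.ext fun i j => by
    simp only [restrict_apply, extend_apply]
    split_ifs with hc
    · rfl
    · exact (T.1.zeros hc).symm
  right_inv := by
    rintro ⟨⟨T, hT⟩, hκ⟩
    change T.shapeLT n = κ at hκ
    refine Subtype.ext (Subtype.ext (SemistandardYoungTableau.ext fun i j => ?_))
    simp only [restrict_apply, extend_apply]
    split_ifs with h1 h2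
    · rfl
    · rw [← hκ, mem_shapeLT] at h1
      have := hT.lt h2
      by_contra hne
      exact h1 ⟨h2, by omega⟩
    · exact (T.zeros h2).symm

theorem tsum_hasWeight_eq_chainCount {n : ℕ} (μ : Fin n → ℕ) (lam : YoungDiagram) :
    ∑' _ : {T : SemistandardYoungTableau lam // T.HasWeight μ}, (1 : ℝ≥0∞) =
      YoungDiagram.chainCount n μ lam := by
  induction n generalizing lam with
  | zero =>
    by_cases h : lam = ⊥
    · subst h
      have hz : ∀ T : SemistandardYoungTableau ⊥, T = default := fun T =>
        SemistandardYoungTableau.ext fun i j => by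
          rw [T.zeros (YoungDiagram.notMem_bot _),
            (default : SemistandardYoungTableau ⊥).zeros (YoungDiagram.notMem_bot _)]
      have hw : (default : SemistandardYoungTableau ⊥).HasWeight μ := fun j => by
        simp [ssytWeight]
      rw [tsum_eq_single ⟨default, hw⟩ fun T hT => absurd (Subtype.ext (hz T.1)) hT]
      simp [YoungDiagram.chainCount]
    · have : IsEmpty {T : SemistandardYoungTableau lam // T.HasWeight μ} := by
        refine ⟨fun T => h (le_bot_iff.1 fun ⟨i, j⟩ hc => ?_)⟩
        exact absurd (T.2.lt hc) (Nat.not_lt_zero _)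
      simp [YoungDiagram.chainCount, h]
  | succ n ih =>
    rw [← (Equiv.sigmaFiberEquiv fun T : {T : SemistandardYoungTableau lam // T.HasWeight μ} =>
      T.1.shapeLT n).tsum_eq, ENNReal.tsum_sigma', YoungDiagram.chainCount]
    refine tsum_congr fun κ => ?_
    unfold YoungDiagram.stripWeight
    split_ifs with h
    · rw [one_mul, ← ih, ← (extendEquiv h.1 h.2).tsum_eq]
    · have : IsEmpty {T : {T : SemistandardYoungTableau lam // T.HasWeight μ} //
          T.1.shapeLT n = κ} := by
        refine ⟨?_⟩
        rintro ⟨⟨T, hT⟩, rfl⟩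
        have h1 := T.shapeLT_interlaces hT
        exact h ⟨h1, (T.restrict_shapeLT_hasWeight hT h1.le).2⟩
      simp

theorem encard_hasWeight {n : ℕ} (μ : Fin n → ℕ) (lam : YoungDiagram) :
    ({T : SemistandardYoungTableau lam | T.HasWeight μ}.encard : ℝ≥0∞) =
      YoungDiagram.chainCount n μ lam :=
  (ENNReal.tsum_set_one _).symm.trans (tsum_hasWeight_eq_chainCount μ lam)

end SemistandardYoungTableau

theorem symmMatrixSum_indicator (n k : ℕ) (μ : Fin n → ℕ) :
    symmMatrixSum n μ (fun q => if q = k then 1 else 0) =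
      ({A : Matrix (Fin n) (Fin n) ℕ | A.IsSymm ∧ (∀ i, ∑ j, A i j = μ i) ∧
          (Finset.univ.filter fun i => A i i % 2 = 1).card = k}.encard : ℝ≥0∞) := by
  rw [← ENNReal.tsum_set_one, tsum_subtype _ (fun _ => (1 : ℝ≥0∞))]
  simp only [symmMatrixSum, ← ite_and]
  rw [← YoungDiagram.tsum_ite_and (fun A : Matrix (Fin n) (Fin n) ℕ => A.IsSymm)
    (fun A => (∀ i, ∑ j, A i j = μ i) ∧ (Finset.univ.filter fun i => A i i % 2 = 1).card = k)
    (fun _ => 1)]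
  exact tsum_congr fun A => by simp only [Set.indicator, Set.mem_ofPred_eq]

theorem finite_symmMatrix (n k : ℕ) (μ : Fin n → ℕ) :
    {A : Matrix (Fin n) (Fin n) ℕ | A.IsSymm ∧ (∀ i, ∑ j, A i j = μ i) ∧
      (Finset.univ.filter fun i => A i i % 2 = 1).card = k}.Finite := by
  refine (Set.finite_Iic (fun i _ => μ i : Fin n → Fin n → ℕ)).subset ?_
  rintro A ⟨-, hA, -⟩ i j
  change A i j ≤ μ i
  rw [← hA i]
  exact Finset.single_le_sum (f := fun j => A i j) (fun _ _ => Nat.zero_le _) (Finset.mem_univ j)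

end counting

/-- **Schützenberger's lemma for the Burge correspondence, enumerative form.** The number of
symmetric `n × n` matrices of nonnegative integers with row sums `μ` (summing to `d`) having
exactly `k` odd diagonal entries equals the number of semistandard Young tableaux of weight `μ`
whose shape `λ ⊢ d` has exactly `k` odd rows. -/
theorem burge_schuetzenberger_card (n d k : ℕ) (μ : Fin n → ℕ) (hμ : ∑ j, μ j = d) :
    Set.ncard {A : Matrix (Fin n) (Fin n) ℕ |
        A.IsSymm ∧ (∀ i, ∑ j, A i j = μ i) ∧
          (Finset.univ.filter fun i => A i i % 2 = 1).card = k} =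
      ∑ᶠ (lam : YoungDiagram) (_ : lam.card = d ∧ oddRowsCount lam = k), tabCard lam μ := by
  classical
  have hsum := symmMatrixSum_eq_chainSum n μ (fun q => if q = k then 1 else 0)
  have hfin := finite_symmMatrix n k μ
  rw [symmMatrixSum_indicator, ← hfin.cast_ncard_eq, ENat.toENNReal_coe] at hsum
  have htop : YoungDiagram.chainSum n μ (fun q => if q = k then 1 else 0) ≠ ⊤ :=
    hsum ▸ ENNReal.natCast_ne_top _
  have hsupp : {lam | oddRowsCount lam = k ∧ YoungDiagram.chainCount n μ lam ≠ 0}.Finite := by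
    refine (ENNReal.finite_const_le_of_tsum_ne_top htop one_ne_zero).subset ?_
    rintro lam ⟨h1, h2⟩
    rw [← SemistandardYoungTableau.encard_hasWeight] at h2
    simp only [Set.mem_ofPred_eq, h1, if_true, one_mul]
    rw [← SemistandardYoungTableau.encard_hasWeight, ← ENat.toENNReal_one, ENat.toENNReal_le]
    exact Order.one_le_iff_ne_zero.2 fun h => h2 (by simp [h])
  have hcard : ∀ lam, oddRowsCount lam = k →
      YoungDiagram.chainCount n μ lam = (tabCard lam μ : ℕ) := by
    intro lam hlam
    have hle := ENNReal.le_tsum (f := fun lam => (if oddRowsCount lam = k then (1 : ENNReal) else 0) *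
      YoungDiagram.chainCount n μ lam) lam
    have hne : YoungDiagram.chainCount n μ lam ≠ ⊤ := by
      rw [if_pos hlam, one_mul] at hle
      exact ne_top_of_le_ne_top htop hle
    rw [← SemistandardYoungTableau.encard_hasWeight] at hne ⊢
    have hf : {T : SemistandardYoungTableau lam | T.HasWeight μ}.Finite := by
      rw [← Set.encard_ne_top_iff]
      exact fun h => hne (by rw [h, ENat.toENNReal_top])
    rw [← hf.cast_ncard_eq, ENat.toENNReal_coe]
    rfl
  have hterm : ∀ lam, (∑ᶠ (_ : lam.card = d ∧ oddRowsCount lam = k), tabCard lam μ) =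
      if oddRowsCount lam = k then tabCard lam μ else 0 := by
    intro lam
    rw [finsum_eq_if]
    by_cases h2 : oddRowsCount lam = k
    · by_cases h1 : lam.card = d
      · simp [h1, h2]
      · simp only [h1, h2, false_and, if_false, if_true]
        by_contra h0
        apply h1
        rw [YoungDiagram.card_eq_of_chainCount_ne_zero (n := n) (μ := μ), hμ]
        rw [hcard lam h2]
        exact_mod_cast Ne.symm h0
    · simp [h2]
  simp only [hterm]
  rw [finsum_eq_sum_of_support_subset (s := hsupp.toFinset)]
  · rw [← Nat.cast_inj (R := ENNReal), hsum, YoungDiagram.chainSum,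
      tsum_eq_sum (s := hsupp.toFinset), Nat.cast_sum]
    · refine Finset.sum_congr rfl fun lam hlam => ?_
      have h := (hsupp.mem_toFinset.1 hlam).1
      rw [if_pos h, if_pos h, one_mul, hcard lam h]
    · intro lam hlam
      rw [hsupp.mem_toFinset] at hlam
      by_cases h : oddRowsCount lam = k
      · have : YoungDiagram.chainCount n μ lam = 0 := by
          by_contra h'
          exact hlam ⟨h, h'⟩
        simp [this]
      · simp [h]
  · intro lam hlam
    rw [Function.mem_support] at hlam
    have h : oddRowsCount lam = k := by
      by_contra h
      simp [h] at hlam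
    rw [if_pos h] at hlam
    rw [hsupp.coe_toFinset]
    refine ⟨h, ?_⟩
    rw [hcard lam h]
    exact_mod_cast hlam
end

section
/- For every nonnegative integer vector μ = (μ_1,…,μ_n) with sum d, the number of symmetric n×n matrices with entries in {0,1}, zero diagonal, and row sums μ_1,…,μ_n equals the sum over all threshold partitions λ of d of |Tab(λ,μ)|. -/
namespace Burge

open Finset

section Algebra

variable {R : Type*} [CommSemiring R]

theorem prod_telescope (M U V : ℕ → R) (n : ℕ)
    (h : ∀ i < n, M (i + 1) * U i = M i * V i) :
    M n * ∏ i ∈ range n, U i = M 0 * ∏ i ∈ range n, V i := by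
  induction n with
  | zero => simp
  | succ n ih =>
    rw [prod_range_succ, prod_range_succ, mul_comm _ (U n), ← mul_assoc, h n (by omega),
      mul_right_comm, ih fun i hi => h i (by omega), mul_assoc]

/-- The weight recording how many ways an interlacing inequality `b ≤ a` leaves room
for a unit move. -/
def gapWeight (z : R) (a b : ℕ) : R :=
  if a < b then 0 else if a = b then 1 else 1 + z

/-- The `i`-th factor of the sum over common upper neighbours. -/
def upFactor (x y : R) (lp lam mu : ℕ) : R :=
  ∑ k ∈ Icc (max mu lam) (min (mu + 1) lp), x ^ (k - lam) * y ^ (k - mu)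

/-- The `i`-th factor of the sum over common lower neighbours. -/
def downFactor (x y : R) (lam mu mn : ℕ) : R :=
  ∑ k ∈ Icc (max (lam - 1) mn) (min lam mu), x ^ (mu - k) * y ^ (lam - k)

theorem upFactor_of_le (x y : R) {lp lam mu : ℕ} (h : lam ≤ mu) :
    upFactor x y lp lam mu = x ^ (mu - lam) * gapWeight (x * y) lp mu := by
  unfold upFactor gapWeight
  rw [max_eq_left h]
  rcases lt_trichotomy lp mu with hlt | rfl | hgt
  · rw [Icc_eq_empty (by omega)]
    simp [hlt]
  · rw [min_eq_right (by omega)]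
    simp
  · rw [min_eq_left (by omega), if_neg (by omega), if_neg (by omega),
      ← Finset.sum_Ioc_add_eq_sum_Icc (by omega), Nat.Ioc_succ_singleton, sum_singleton,
      show mu + 1 - lam = (mu - lam) + 1 by omega, show mu + 1 - mu = 1 by omega]
    simp
    ring

theorem downFactor_of_le (x y : R) {lam mu mn : ℕ} (h : lam ≤ mu) :
    downFactor x y lam mu mn = x ^ (mu - lam) * gapWeight (x * y) lam mn := by
  unfold downFactor gapWeight
  rw [min_eq_left h]
  rcases lt_trichotomy lam mn with hlt | rfl | hgt
  · rw [Icc_eq_empty (by omega)]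
    simp [hlt]
  · rw [max_eq_right (by omega)]
    simp
  · obtain ⟨l, rfl⟩ : ∃ l, lam = l + 1 := ⟨lam - 1, by omega⟩
    rw [max_eq_left (by omega), if_neg (by omega), if_neg (by omega), Nat.add_sub_cancel,
      ← Finset.sum_Ioc_add_eq_sum_Icc (by omega), Nat.Ioc_succ_singleton, sum_singleton,
      show mu - l = (mu - (l + 1)) + 1 by omega, show l + 1 - l = 1 by omega]
    simp
    ring

theorem gapWeight_mul_upFactor (x y : R) {lp lam mu mn : ℕ} (h₁ : lam ≤ lp) (h₂ : mn ≤ mu) :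
    gapWeight (x * y) lam mn * upFactor x y lp lam mu =
      gapWeight (x * y) lp mu * downFactor x y lam mu mn := by
  rcases Nat.lt_or_ge mu lam with h | h
  · rcases Nat.lt_or_ge (mu + 1) lam with h' | h'
    · rw [upFactor, downFactor, Icc_eq_empty (by omega), Icc_eq_empty (by omega)]
      simp
    · obtain rfl : lam = mu + 1 := by omega
      unfold gapWeight upFactor downFactor
      rw [max_eq_right (by omega), min_eq_left (by omega), max_eq_left (by omega),
        min_eq_right (by omega), if_neg (by omega), if_neg (by omega), if_neg (by omega),
        if_neg (by omega)]
      simp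
  · rw [upFactor_of_le x y h, downFactor_of_le x y h]
    ring

/-- A sum over a family of objects whose coordinates range freely over intervals is a product. -/
theorem sum_eq_prod_of_coords {ι : Type*} (s : Finset ι) (N : ℕ) (c : ι → ℕ → ℕ) (l u : ℕ → ℕ)
    (w : ℕ → ℕ → R)
    (inj : ∀ a ∈ s, ∀ b ∈ s, (∀ i < N, c a i = c b i) → a = b)
    (mem : ∀ a ∈ s, ∀ i < N, l i ≤ c a i ∧ c a i ≤ u i)
    (surj : ∀ f : ℕ → ℕ, (∀ i < N, l i ≤ f i ∧ f i ≤ u i) → (∀ i, N ≤ i → f i = 0) →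
      ∃ a ∈ s, ∀ i < N, c a i = f i) :
    ∑ a ∈ s, ∏ i ∈ range N, w i (c a i) =
      ∏ i ∈ range N, ∑ k ∈ Icc (l i) (u i), w i k := by
  classical
  rw [← Fin.prod_univ_eq_prod_range (fun i => ∑ k ∈ Icc (l i) (u i), w i k), Finset.prod_univ_sum]
  refine sum_bij (fun a _ i => c a i) ?_ ?_ ?_ ?_
  · intro a ha
    simpa [Fintype.mem_piFinset] using fun i : Fin N => mem a ha i i.2
  · intro a ha b hb hab
    exact inj a ha b hb fun i hi => congrFun hab ⟨i, hi⟩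
  · intro f hf
    rw [Fintype.mem_piFinset] at hf
    obtain ⟨a, ha, hfa⟩ := surj (fun i => if h : i < N then f ⟨i, h⟩ else 0)
      (fun i hi => by simpa [hi] using hf ⟨i, hi⟩) (fun i hi => by simp [hi])
    exact ⟨a, ha, funext fun i => by simpa using hfa i i.2⟩
  · intro a _
    exact (Fin.prod_univ_eq_prod_range (fun i => w i (c a i)) N).symm

end Algebra

section Diagrams

open YoungDiagram

theorem le_iff_forall_rowLen {ρ ν : YoungDiagram} : ρ ≤ ν ↔ ∀ i, ρ.rowLen i ≤ ν.rowLen i := by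
  constructor
  · intro h i
    by_contra! hlt
    have := h (mem_iff_lt_rowLen.2 hlt)
    exact lt_irrefl _ (mem_iff_lt_rowLen.1 this)
  · rintro h ⟨i, j⟩ hc
    exact mem_iff_lt_rowLen.2 ((mem_iff_lt_rowLen.1 hc).trans_le (h i))

theorem eq_of_rowLen_eq {ρ ν : YoungDiagram} (h : ∀ i, ρ.rowLen i = ν.rowLen i) : ρ = ν :=
  le_antisymm (le_iff_forall_rowLen.2 fun i => (h i).le) (le_iff_forall_rowLen.2 fun i => (h i).ge)

theorem card_eq_sum_rowLen {ν : YoungDiagram} {N : ℕ} (h : ν.rowLen N = 0) :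
    ν.card = ∑ i ∈ range N, ν.rowLen i := by
  have hmaps : ∀ c ∈ ν.cells, c.1 ∈ range N := by
    rintro ⟨i, j⟩ hc
    by_contra hi
    have := ν.rowLen_anti N i (by simpa using hi)
    have := mem_iff_lt_rowLen.1 ((mem_cells _).1 hc)
    omega
  rw [YoungDiagram.card, card_eq_sum_card_fiberwise hmaps]
  exact sum_congr rfl fun i _ => (ν.rowLen_eq_card).symm

/-- The diagram with row lengths `f`, where `f` is antitone and vanishes from `N` on. -/
def ofRowFun (f : ℕ → ℕ) (N : ℕ) (hf : Antitone f) : YoungDiagram where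
  cells := (range N ×ˢ range (f 0)).filter fun c => c.2 < f c.1
  isLowerSet := by
    rintro ⟨i, j⟩ ⟨i', j'⟩ ⟨hi, hj⟩ h
    simp only [coe_filter, mem_product, mem_range, Set.mem_ofPred_eq] at h ⊢
    have := hf hi
    dsimp at hi hj this
    omega

theorem rowLen_ofRowFun {f : ℕ → ℕ} {N : ℕ} (hf : Antitone f) (h0 : ∀ i, N ≤ i → f i = 0) (i : ℕ) :
    (ofRowFun f N hf).rowLen i = f i := by
  have key : ∀ j, j < (ofRowFun f N hf).rowLen i ↔ j < f i := by
    intro j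
    rw [← mem_iff_lt_rowLen, ← mem_cells]
    simp only [ofRowFun, mem_filter, mem_product, mem_range]
    have := hf (Nat.zero_le i)
    have := h0 i
    omega
  have h1 := key (f i)
  have h2 := key ((ofRowFun f N hf).rowLen i)
  omega

/-- `ν / ρ` is a horizontal strip. -/
def HStrip (ν ρ : YoungDiagram) : Prop :=
  ∀ i, ρ.rowLen i ≤ ν.rowLen i ∧ ν.rowLen (i + 1) ≤ ρ.rowLen i

/-- `ν / τ` is a vertical strip. -/
def VStrip (ν τ : YoungDiagram) : Prop :=
  ∀ i, τ.rowLen i ≤ ν.rowLen i ∧ ν.rowLen i ≤ τ.rowLen i + 1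

noncomputable instance : DecidableRel HStrip := fun _ _ => Classical.propDecidable _

noncomputable instance : DecidableRel VStrip := fun _ _ => Classical.propDecidable _

noncomputable instance : DecidablePred YoungDiagram.IsThreshold :=
  fun _ => Classical.propDecidable _

theorem HStrip.le {ν ρ : YoungDiagram} (h : HStrip ν ρ) : ρ ≤ ν :=
  le_iff_forall_rowLen.2 fun i => (h i).1

theorem VStrip.le {ν ρ : YoungDiagram} (h : VStrip ν ρ) : ρ ≤ ν :=
  le_iff_forall_rowLen.2 fun i => (h i).1

theorem hstrip_iff_cells {ν ρ : YoungDiagram} :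
    HStrip ν ρ ↔ ρ ≤ ν ∧ ∀ i j, (i + 1, j) ∈ ν → (i, j) ∈ ρ := by
  simp only [mem_iff_lt_rowLen]
  constructor
  · exact fun h => ⟨h.le, fun i j hij => hij.trans_le (h i).2⟩
  · refine fun h i => ⟨le_iff_forall_rowLen.1 h.1 i, ?_⟩
    by_contra! hlt
    exact lt_irrefl _ (h.2 i _ hlt)

theorem vstrip_iff_cells {ν τ : YoungDiagram} :
    VStrip ν τ ↔ τ ≤ ν ∧ ∀ i j, (i, j + 1) ∈ ν → (i, j) ∈ τ := by
  simp only [mem_iff_lt_rowLen]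
  constructor
  · refine fun h => ⟨h.le, fun i j hij => ?_⟩
    have := (h i).2
    omega
  · refine fun h i => ⟨le_iff_forall_rowLen.1 h.1 i, ?_⟩
    by_contra! hlt
    exact lt_irrefl _ (h.2 i _ hlt)

theorem cells_injective : Function.Injective YoungDiagram.cells := fun _ _ h => YoungDiagram.ext h

/-- The finite set of diagrams contained in a finite set of cells. -/
noncomputable def diagramsIn (B : Finset (ℕ × ℕ)) : Finset YoungDiagram :=
  B.powerset.preimage YoungDiagram.cells cells_injective.injOn

theorem mem_diagramsIn {B : Finset (ℕ × ℕ)} {ν : YoungDiagram} : ν ∈ diagramsIn B ↔ ν.cells ⊆ B := by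
  rw [diagramsIn, mem_preimage, mem_powerset]

theorem mem_diagramsIn_box {N M : ℕ} {ν : YoungDiagram} :
    ν ∈ diagramsIn (range N ×ˢ range M) ↔ ν.rowLen N = 0 ∧ (0 < N → ν.rowLen 0 ≤ M) := by
  rw [mem_diagramsIn]
  constructor
  · intro h
    constructor
    · by_contra hN
      have := h ((mem_cells _).2 (mem_iff_lt_rowLen.2 (Nat.pos_of_ne_zero hN)))
      simp at this
    · intro hN
      by_contra! hM
      have := h ((mem_cells _).2 (mem_iff_lt_rowLen.2 hM))
      simp at this
  · rintro ⟨hN, hM⟩ ⟨i, j⟩ hc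
    have hc := mem_iff_lt_rowLen.1 ((mem_cells _).1 hc)
    have hi : i < N := by
      by_contra! hi
      have := ν.rowLen_anti _ _ hi
      omega
    have := ν.rowLen_anti _ _ (Nat.zero_le i)
    have := hM (by omega)
    simp only [mem_product, mem_range]
    omega

/-- The diagrams obtained from `ν` by removing a horizontal strip. -/
noncomputable def hDown (ν : YoungDiagram) : Finset YoungDiagram :=
  (diagramsIn ν.cells).filter (HStrip ν)

theorem mem_hDown {ν ρ : YoungDiagram} : ρ ∈ hDown ν ↔ HStrip ν ρ := by
  rw [hDown, mem_filter, mem_diagramsIn, and_iff_right_iff_imp]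
  exact fun h => cells_subset_iff.2 h.le

end Diagrams

section LocalRule

open YoungDiagram

theorem rowLen_eq_zero_of_le {ν : YoungDiagram} {i j : ℕ} (hij : i ≤ j) (h : ν.rowLen i = 0) :
    ν.rowLen j = 0 :=
  Nat.eq_zero_of_le_zero (h ▸ ν.rowLen_anti i j hij)

theorem card_sub_card_eq_sum {ν ρ : YoungDiagram} (h : ρ ≤ ν) {N : ℕ} (hN : ν.rowLen N = 0) :
    ν.card - ρ.card = ∑ i ∈ range N, (ν.rowLen i - ρ.rowLen i) := by
  have hle := le_iff_forall_rowLen.1 h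
  have hρ : ρ.rowLen N = 0 := Nat.eq_zero_of_le_zero (hN ▸ hle N)
  rw [card_eq_sum_rowLen hN, card_eq_sum_rowLen hρ, sum_tsub_distrib _ fun i _ => hle i]

variable {R : Type*} [CommSemiring R]

/-- The local rule: removing a vertical strip commutes with adding a horizontal strip,
up to the factor `1 + x * y`. -/
theorem sum_upper_eq_sum_lower (x y : R) {ρ τ : YoungDiagram} {N M : ℕ} (hρ : ρ.rowLen N = 0)
    (hτ : τ.rowLen (N + 1) = 0) (hM : τ.rowLen 0 + 1 ≤ M) :
    ∑ ν ∈ (diagramsIn (range (N + 1) ×ˢ range M)).filter fun ν => VStrip ν τ ∧ HStrip ν ρ,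
        x ^ (ν.card - ρ.card) * y ^ (ν.card - τ.card) =
      (1 + x * y) * ∑ σ ∈ (hDown τ).filter fun σ => VStrip ρ σ,
        x ^ (τ.card - σ.card) * y ^ (ρ.card - σ.card) := by
  have hρ' : ρ.rowLen (N + 1) = 0 := rowLen_eq_zero_of_le (Nat.le_succ N) hρ
  set lp : ℕ → ℕ := fun i => if i = 0 then ρ.rowLen 0 + τ.rowLen 0 + 1 else ρ.rowLen (i - 1)
    with hlp
  have hup : ∑ ν ∈ (diagramsIn (range (N + 1) ×ˢ range M)).filter fun ν => VStrip ν τ ∧ HStrip ν ρ,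
        x ^ (ν.card - ρ.card) * y ^ (ν.card - τ.card) =
      ∏ i ∈ range (N + 1), upFactor x y (lp i) (ρ.rowLen i) (τ.rowLen i) := by
    unfold upFactor
    rw [← sum_eq_prod_of_coords _ (N + 1) YoungDiagram.rowLen]
    · refine sum_congr rfl fun ν hν => ?_
      simp only [mem_filter, mem_diagramsIn_box] at hν
      obtain ⟨⟨hN, -⟩, hv, hh⟩ := hν
      rw [card_sub_card_eq_sum hh.le hN, card_sub_card_eq_sum hv.le hN, prod_mul_distrib,
        prod_pow_eq_pow_sum, prod_pow_eq_pow_sum]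
    · intro a ha b hb hab
      simp only [mem_filter, mem_diagramsIn_box] at ha hb
      refine eq_of_rowLen_eq fun i => ?_
      rcases Nat.lt_or_ge i (N + 1) with hi | hi
      · exact hab i hi
      · rw [rowLen_eq_zero_of_le hi ha.1.1, rowLen_eq_zero_of_le hi hb.1.1]
    · intro ν hν i hi
      simp only [mem_filter, mem_diagramsIn_box] at hν
      obtain ⟨-, hv, hh⟩ := hν
      have h1 := hv i
      have h2 := hh i
      rcases i with _ | i
      · simp [hlp]
        omega
      · have h3 := hh i
        simp [hlp]
        omega
    · intro f hf hf0
      have hanti : Antitone f := by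
        refine antitone_nat_of_succ_le fun i => ?_
        rcases Nat.lt_or_ge (i + 1) (N + 1) with hi | hi
        · have h1 := (hf (i + 1) hi).2
          have h2 := (hf i (by omega)).1
          simp [hlp] at h1 h2
          omega
        · rw [hf0 _ hi]
          exact Nat.zero_le _
      have hrow := rowLen_ofRowFun hanti hf0
      refine ⟨ofRowFun f (N + 1) hanti, ?_, fun i _ => hrow i⟩
      simp only [mem_filter, mem_diagramsIn_box]
      simp only [VStrip, HStrip, hrow]
      refine ⟨⟨hf0 _ le_rfl, fun _ => ?_⟩, fun i => ?_, fun i => ?_⟩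
      · have := (hf 0 (by omega)).2
        omega
      · rcases Nat.lt_or_ge i (N + 1) with hi | hi
        · have := hf i hi
          omega
        · rw [hf0 _ hi, rowLen_eq_zero_of_le hi hτ]
          omega
      · rcases Nat.lt_or_ge i (N + 1) with hi | hi
        · refine ⟨by have := hf i hi; omega, ?_⟩
          rcases Nat.lt_or_ge (i + 1) (N + 1) with hi' | hi'
          · have := (hf (i + 1) hi').2
            simp [hlp] at this
            omega
          · rw [hf0 _ hi']
            exact Nat.zero_le _
        · rw [hf0 _ hi, hf0 _ (Nat.le_succ_of_le hi), rowLen_eq_zero_of_le hi hρ']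
          omega
  have hdown : ∑ σ ∈ (hDown τ).filter fun σ => VStrip ρ σ,
        x ^ (τ.card - σ.card) * y ^ (ρ.card - σ.card) =
      ∏ i ∈ range (N + 1), downFactor x y (ρ.rowLen i) (τ.rowLen i) (τ.rowLen (i + 1)) := by
    unfold downFactor
    rw [← sum_eq_prod_of_coords _ (N + 1) YoungDiagram.rowLen]
    · refine sum_congr rfl fun σ hσ => ?_
      simp only [mem_filter, mem_hDown] at hσ
      rw [card_sub_card_eq_sum hσ.1.le hτ, card_sub_card_eq_sum hσ.2.le hρ', prod_mul_distrib,
        prod_pow_eq_pow_sum, prod_pow_eq_pow_sum]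
    · intro a ha b hb hab
      simp only [mem_filter, mem_hDown] at ha hb
      refine eq_of_rowLen_eq fun i => ?_
      rcases Nat.lt_or_ge i (N + 1) with hi | hi
      · exact hab i hi
      · have := ha.1 i
        have := hb.1 i
        have := rowLen_eq_zero_of_le hi hτ
        omega
    · intro σ hσ i hi
      simp only [mem_filter, mem_hDown] at hσ
      have h1 := hσ.1 i
      have h2 := hσ.2 i
      omega
    · intro f hf hf0
      have hanti : Antitone f := by
        refine antitone_nat_of_succ_le fun i => ?_
        rcases Nat.lt_or_ge (i + 1) (N + 1) with hi | hi
        · have h1 := (hf (i + 1) hi).2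
          have h2 := (hf i (by omega)).1
          omega
        · rw [hf0 _ hi]
          exact Nat.zero_le _
      have hrow := rowLen_ofRowFun hanti hf0
      refine ⟨ofRowFun f (N + 1) hanti, ?_, fun i _ => hrow i⟩
      simp only [mem_filter, mem_hDown]
      simp only [VStrip, HStrip, hrow]
      refine ⟨fun i => ?_, fun i => ?_⟩ <;> rcases Nat.lt_or_ge i (N + 1) with hi | hi
      · have := hf i hi
        omega
      · rw [hf0 _ hi, rowLen_eq_zero_of_le (Nat.le_succ_of_le hi) hτ]
        omega
      · have := hf i hi
        omega
      · rw [hf0 _ hi, rowLen_eq_zero_of_le hi hρ']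
        omega
  have htel := prod_telescope (fun i => gapWeight (x * y) (lp i) (τ.rowLen i)) _ _ (N + 1)
    fun i _ => gapWeight_mul_upFactor x y (lp := lp i) (lam := ρ.rowLen i) (mu := τ.rowLen i)
      (mn := τ.rowLen (i + 1)) (by
        rcases i with _ | i
        · simp [hlp]
          omega
        · simpa [hlp] using ρ.rowLen_anti i (i + 1) (Nat.le_succ i))
      (τ.rowLen_anti i (i + 1) (Nat.le_succ i))
  have hlast : gapWeight (x * y) (lp (N + 1)) (τ.rowLen (N + 1)) = 1 := by
    simp [gapWeight, hlp, hρ, hτ]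
  have hfirst : gapWeight (x * y) (lp 0) (τ.rowLen 0) = 1 + x * y := by
    rw [gapWeight, if_neg (by simp [hlp]; omega), if_neg (by simp [hlp]; omega)]
  rw [hup, hdown, ← hfirst, ← htel, hlast, one_mul]

end LocalRule

section Tableaux

open YoungDiagram

theorem finite_ssyt_below (n : ℕ) (ν : YoungDiagram) :
    {T : SemistandardYoungTableau ν | ∀ c ∈ ν.cells, T c.1 c.2 < n}.Finite := by
  rw [← Set.finite_coe_iff]
  refine Finite.of_injective
    (fun T (c : ν.cells) => (⟨T.1 c.1.1 c.1.2, T.2 c.1 c.2⟩ : Fin n)) fun T T' h => ?_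
  refine Subtype.ext (SemistandardYoungTableau.ext fun i j => ?_)
  by_cases hc : (i, j) ∈ ν.cells
  · simpa using congrFun h ⟨(i, j), hc⟩
  · rw [T.1.zeros hc, T'.1.zeros hc]

/-- The finite set of tableaux of shape `ν` all of whose entries are `< n`. -/
noncomputable def ssytBelow (n : ℕ) (ν : YoungDiagram) : Finset (SemistandardYoungTableau ν) :=
  (finite_ssyt_below n ν).toFinset

theorem mem_ssytBelow {n : ℕ} {ν : YoungDiagram} {T : SemistandardYoungTableau ν} :
    T ∈ ssytBelow n ν ↔ ∀ i j, (i, j) ∈ ν → T i j < n := by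
  simp [ssytBelow]

/-- The sub-diagram of cells whose entry is less than `n`. -/
def shapeLT {ν : YoungDiagram} (T : SemistandardYoungTableau ν) (n : ℕ) : YoungDiagram where
  cells := ν.cells.filter fun c => T c.1 c.2 < n
  isLowerSet := by
    rintro ⟨i, j⟩ ⟨i', j'⟩ ⟨hi, hj⟩ h
    simp only [coe_filter, Set.mem_ofPred_eq, mem_cells] at h ⊢
    dsimp at hi hj
    refine ⟨ν.up_left_mem hi hj h.1, ?_⟩
    exact ((T.col_weak hi (ν.up_left_mem le_rfl hj h.1)).trans
      (T.row_weak_of_le hj h.1)).trans_lt h.2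

theorem mem_shapeLT {ν : YoungDiagram} {T : SemistandardYoungTableau ν} {n i j : ℕ} :
    (i, j) ∈ shapeLT T n ↔ (i, j) ∈ ν ∧ T i j < n := by
  rw [← mem_cells, shapeLT]
  simp

theorem hstrip_shapeLT {n : ℕ} {ν : YoungDiagram} {T : SemistandardYoungTableau ν}
    (hT : T ∈ ssytBelow (n + 1) ν) : HStrip ν (shapeLT T n) := by
  rw [mem_ssytBelow] at hT
  refine hstrip_iff_cells.2 ⟨?_, fun i j hij => ?_⟩
  · rintro ⟨i, j⟩ h
    exact (mem_shapeLT.1 h).1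
  · refine mem_shapeLT.2 ⟨ν.up_left_mem (Nat.le_succ i) le_rfl hij, ?_⟩
    have h1 := hT _ _ hij
    have h2 := T.col_strict (Nat.lt_add_one i) hij
    omega

/-- The restriction of a tableau to a smaller diagram. -/
def restrict {ν ρ : YoungDiagram} (h : ρ ≤ ν) (T : SemistandardYoungTableau ν) :
    SemistandardYoungTableau ρ where
  entry i j := if (i, j) ∈ ρ then T i j else 0
  row_weak' hj hc := by
    rw [if_pos hc, if_pos (ρ.up_left_mem le_rfl hj.le hc)]
    exact T.row_weak hj (h hc)
  col_strict' hi hc := by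
    rw [if_pos hc, if_pos (ρ.up_left_mem hi.le le_rfl hc)]
    exact T.col_strict hi (h hc)
  zeros' hc := if_neg hc

theorem restrict_apply {ν ρ : YoungDiagram} (h : ρ ≤ ν) (T : SemistandardYoungTableau ν)
    (i j : ℕ) : restrict h T i j = if (i, j) ∈ ρ then T i j else 0 := rfl

/-- The extension of a tableau with entries `< n` by a horizontal strip filled with `n`. -/
def extend {ν ρ : YoungDiagram} (h : HStrip ν ρ) (n : ℕ) (T : SemistandardYoungTableau ρ)
    (hT : ∀ i j, (i, j) ∈ ρ → T i j < n) : SemistandardYoungTableau ν where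
  entry i j := if (i, j) ∈ ρ then T i j else if (i, j) ∈ ν then n else 0
  row_weak' {i j1 j2} hj hc := by
    have hc1 := ν.up_left_mem le_rfl hj.le hc
    by_cases h2 : (i, j2) ∈ ρ
    · rw [if_pos h2, if_pos (ρ.up_left_mem le_rfl hj.le h2)]
      exact T.row_weak hj h2
    · rw [if_neg h2, if_pos hc, if_pos hc1]
      split_ifs with h1
      · exact (hT _ _ h1).le
      · exact le_rfl
  col_strict' {i1 i2 j} hi hc := by
    obtain ⟨k, rfl⟩ : ∃ k, i2 = k + 1 := ⟨i2 - 1, by omega⟩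
    have h1 : (i1, j) ∈ ρ :=
      ρ.up_left_mem (Nat.le_of_lt_succ hi) le_rfl ((hstrip_iff_cells.1 h).2 _ _ hc)
    rw [if_pos h1, if_pos hc]
    split_ifs with h2
    · exact T.col_strict hi h2
    · exact hT _ _ h1
  zeros' {i j} hc := by
    rw [if_neg fun hρ => hc (h.le hρ), if_neg hc]

theorem extend_apply {ν ρ : YoungDiagram} (h : HStrip ν ρ) (n : ℕ)
    (T : SemistandardYoungTableau ρ) (hT : ∀ i j, (i, j) ∈ ρ → T i j < n) (i j : ℕ) :
    extend h n T hT i j = if (i, j) ∈ ρ then T i j else if (i, j) ∈ ν then n else 0 := rfl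

variable {R : Type*} [CommSemiring R]

/-- The Schur function of `ν` in `n` variables, evaluated at `x 0, …, x (n - 1)`. -/
noncomputable def schurEval (x : ℕ → R) (n : ℕ) (ν : YoungDiagram) : R :=
  ∑ T ∈ ssytBelow n ν, ∏ c ∈ ν.cells, x (T c.1 c.2)

/-- The branching rule. -/
theorem schurEval_succ (x : ℕ → R) (n : ℕ) (ν : YoungDiagram) :
    schurEval x (n + 1) ν = ∑ ρ ∈ hDown ν, x n ^ (ν.card - ρ.card) * schurEval x n ρ := by
  classical
  unfold schurEval
  rw [← sum_fiberwise_of_maps_to (t := hDown ν) (g := fun T => shapeLT T n)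
    fun T hT => mem_hDown.2 (hstrip_shapeLT hT)]
  refine sum_congr rfl fun ρ hρ => ?_
  rw [mem_hDown] at hρ
  rw [mul_sum]
  refine sum_bij' (fun T _ => restrict hρ.le T)
    (fun T hT => extend hρ n T (mem_ssytBelow.1 hT)) ?_ ?_ ?_ ?_ ?_
  · intro T hT
    rw [mem_filter] at hT
    obtain ⟨-, rfl⟩ := hT
    refine mem_ssytBelow.2 fun i j hij => ?_
    rw [restrict_apply, if_pos hij]
    exact (mem_shapeLT.1 hij).2
  · intro T hT
    rw [mem_ssytBelow] at hT
    rw [mem_filter, mem_ssytBelow]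
    constructor
    · intro i j hij
      rw [extend_apply, if_pos hij]
      split_ifs with h
      · exact (hT _ _ h).trans (Nat.lt_succ_self n)
      · exact Nat.lt_succ_self n
    · refine SetLike.ext ?_
      rintro ⟨i, j⟩
      rw [mem_shapeLT, extend_apply]
      constructor
      · rintro ⟨h1, h2⟩
        by_contra h
        rw [if_neg h, if_pos h1] at h2
        exact lt_irrefl _ h2
      · intro h
        rw [if_pos h]
        exact ⟨hρ.le h, hT _ _ h⟩
  · intro T hT
    obtain ⟨hT', rfl⟩ := mem_filter.1 hT
    rw [mem_ssytBelow] at hT'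
    ext i j
    rw [extend_apply, restrict_apply]
    split_ifs with h1 h2
    · rfl
    · rw [mem_shapeLT] at h1
      have := hT' _ _ h2
      have : ¬ T i j < n := fun h => h1 ⟨h2, h⟩
      omega
    · exact (T.zeros h2).symm
  · intro T hT
    ext i j
    rw [restrict_apply, extend_apply]
    split_ifs with h1
    · rfl
    · exact (T.zeros h1).symm
  · intro T hT
    rw [mem_filter, mem_ssytBelow] at hT
    obtain ⟨hT, rfl⟩ := hT
    have hsub : (shapeLT T n).cells ⊆ ν.cells := cells_subset_iff.2 hρ.le
    rw [← prod_sdiff hsub]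
    congr 1
    · rw [YoungDiagram.card, YoungDiagram.card, ← card_sdiff_of_subset hsub]
      refine prod_eq_pow_card ?_
      rintro ⟨i, j⟩ hc
      rw [mem_sdiff, mem_cells, mem_cells, mem_shapeLT] at hc
      have := hT _ _ hc.1
      have : T i j = n := by
        have : ¬ T i j < n := fun h => hc.2 ⟨hc.1, h⟩
        omega
      rw [this]
    · refine prod_congr rfl ?_
      rintro ⟨i, j⟩ hc
      rw [restrict_apply, if_pos ((mem_cells _).1 hc)]

theorem schurEval_zero_bot (x : ℕ → R) : schurEval x 0 ⊥ = 1 := by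
  have : ssytBelow 0 ⊥ = {SemistandardYoungTableau.highestWeight ⊥} := by
    ext T
    simp only [mem_ssytBelow, notMem_bot, mem_singleton, false_imp_iff, implies_true, true_iff]
    ext i j
    rw [T.zeros (notMem_bot _), SemistandardYoungTableau.zeros _ (notMem_bot _)]
  simp [schurEval, this]

theorem le_of_mem_ssyt {ν : YoungDiagram} (T : SemistandardYoungTableau ν) {i j : ℕ}
    (h : (i, j) ∈ ν) : i ≤ T i j := by
  induction i with
  | zero => exact Nat.zero_le _
  | succ i ih =>
    exact (ih (ν.up_left_mem (Nat.le_succ i) le_rfl h)).trans_lt (T.col_strict (Nat.lt_succ_self i) h)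

theorem ssytBelow_eq_empty {n : ℕ} {ν : YoungDiagram} (h : ν.rowLen n ≠ 0) :
    ssytBelow n ν = ∅ := by
  refine eq_empty_of_forall_notMem fun T hT => ?_
  have hc : (n, 0) ∈ ν := mem_iff_lt_rowLen.2 (Nat.pos_of_ne_zero h)
  exact absurd (mem_ssytBelow.1 hT _ _ hc) (le_of_mem_ssyt T hc).not_gt

theorem schurEval_eq_zero (x : ℕ → R) {n : ℕ} {ν : YoungDiagram} (h : ν.rowLen n ≠ 0) :
    schurEval x n ν = 0 := by
  rw [schurEval, ssytBelow_eq_empty h, sum_empty]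

end Tableaux

section Pieri

open YoungDiagram

variable {R : Type*} [CommSemiring R]

theorem eq_bot_of_rowLen_zero {ν : YoungDiagram} (h : ν.rowLen 0 = 0) : ν = ⊥ := by
  refine le_bot_iff.1 ?_
  rintro ⟨i, j⟩ hc
  have := mem_iff_lt_rowLen.1 hc
  rw [rowLen_eq_zero_of_le (Nat.zero_le i) h] at this
  exact absurd this (Nat.not_lt_zero _)

theorem rowLen_bot (i : ℕ) : (⊥ : YoungDiagram).rowLen i = 0 := by
  by_contra h
  exact notMem_bot _ (mem_iff_lt_rowLen.2 (Nat.pos_of_ne_zero h))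

/-- The generating function form of the dual Pieri rule. -/
theorem sum_vstrip_schurEval (x : ℕ → R) (y : R) (n : ℕ) (τ : YoungDiagram)
    (B : Finset YoungDiagram) (hB : ∀ ν, VStrip ν τ → ν.rowLen n = 0 → ν ∈ B) :
    ∑ ν ∈ B.filter fun ν => VStrip ν τ, y ^ (ν.card - τ.card) * schurEval x n ν =
      (∏ i ∈ range n, (1 + x i * y)) * schurEval x n τ := by
  classical
  induction n generalizing τ B with
  | zero =>
    by_cases hτ : τ.rowLen 0 = 0
    · obtain rfl := eq_bot_of_rowLen_zero hτ
      rw [sum_eq_single ⊥]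
      · simp
      · intro ν _ hν
        rw [schurEval_eq_zero x fun h => hν (eq_bot_of_rowLen_zero h), mul_zero]
      · intro h
        refine absurd ?_ h
        have hv : VStrip ⊥ ⊥ := fun i => by simp [rowLen_bot]
        exact mem_filter.2 ⟨hB _ hv (rowLen_bot 0), hv⟩
    · rw [schurEval_eq_zero x hτ, mul_zero]
      refine sum_eq_zero fun ν hν => ?_
      have := (mem_filter.1 hν).2 0
      rw [schurEval_eq_zero x (by omega), mul_zero]
  | succ n ih =>
    by_cases hτ : τ.rowLen (n + 1) = 0
    swap
    · rw [schurEval_eq_zero x hτ, mul_zero]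
      refine sum_eq_zero fun ν hν => ?_
      have := (mem_filter.1 hν).2 (n + 1)
      rw [schurEval_eq_zero x (by omega), mul_zero]
    set M := τ.rowLen 0 + 1 with hM
    set C := diagramsIn (range (n + 1) ×ˢ range M) with hC
    have hmemC : ∀ ν, VStrip ν τ → ν.rowLen (n + 1) = 0 → ν ∈ C := fun ν hν h0 =>
      mem_diagramsIn_box.2 ⟨h0, fun _ => (hν 0).2⟩
    have hBC : ∑ ν ∈ B.filter fun ν => VStrip ν τ, y ^ (ν.card - τ.card) * schurEval x (n + 1) ν =
        ∑ ν ∈ C.filter fun ν => VStrip ν τ, y ^ (ν.card - τ.card) * schurEval x (n + 1) ν := by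
      symm
      refine sum_subset_zero_on_sdiff ?_ ?_ fun _ _ => rfl
      · intro ν hν
        rw [mem_filter] at hν ⊢
        exact ⟨hB ν hν.2 (mem_diagramsIn_box.1 hν.1).1, hν.2⟩
      · intro ν hν
        rw [mem_sdiff, mem_filter, mem_filter] at hν
        rw [schurEval_eq_zero x fun h => hν.2 ⟨hmemC ν hν.1.2 h, hν.1.2⟩, mul_zero]
    calc _ = ∑ ν ∈ C.filter fun ν => VStrip ν τ, ∑ ρ ∈ hDown ν,
          x n ^ (ν.card - ρ.card) * y ^ (ν.card - τ.card) * schurEval x n ρ := by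
          rw [hBC]
          refine sum_congr rfl fun ν _ => ?_
          rw [schurEval_succ, mul_sum]
          exact sum_congr rfl fun ρ _ => by ring
      _ = ∑ ρ ∈ C, ∑ ν ∈ C.filter fun ν => VStrip ν τ ∧ HStrip ν ρ,
          x n ^ (ν.card - ρ.card) * y ^ (ν.card - τ.card) * schurEval x n ρ := by
          refine sum_comm' fun ν ρ => ?_
          simp only [mem_filter, mem_hDown]
          refine ⟨fun h => ⟨⟨h.1.1, h.1.2, h.2⟩, ?_⟩, fun h => ⟨⟨h.1.1, h.1.2.1⟩, h.1.2.2⟩⟩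
          exact mem_diagramsIn.2 ((cells_subset_iff.2 h.2.le).trans (mem_diagramsIn.1 h.1.1))
      _ = ∑ ρ ∈ C, ∑ σ ∈ (hDown τ).filter fun σ => VStrip ρ σ,
          (1 + x n * y) * (x n ^ (τ.card - σ.card) * y ^ (ρ.card - σ.card)) *
            schurEval x n ρ := by
          refine sum_congr rfl fun ρ _ => ?_
          rw [← sum_mul, ← sum_mul, ← mul_sum]
          by_cases hρ : ρ.rowLen n = 0
          · rw [sum_upper_eq_sum_lower (x n) y hρ hτ le_rfl]
          · rw [schurEval_eq_zero x hρ, mul_zero, mul_zero]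
      _ = ∑ σ ∈ hDown τ, ∑ ρ ∈ C.filter fun ρ => VStrip ρ σ,
          (1 + x n * y) * (x n ^ (τ.card - σ.card) * y ^ (ρ.card - σ.card)) *
            schurEval x n ρ := by
          refine sum_comm' fun ρ σ => ?_
          simp only [mem_filter]
          tauto
      _ = ∑ σ ∈ hDown τ, (1 + x n * y) * x n ^ (τ.card - σ.card) *
          ((∏ i ∈ range n, (1 + x i * y)) * schurEval x n σ) := by
          refine sum_congr rfl fun σ hσ => ?_
          rw [mem_hDown] at hσ
          rw [← ih σ C, mul_sum]
          · exact sum_congr rfl fun ρ _ => by ring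
          · intro ρ hρ h0
            refine mem_diagramsIn_box.2 ⟨rowLen_eq_zero_of_le (Nat.le_succ n) h0, fun _ => ?_⟩
            have := (hρ 0).2
            have := (hσ 0).1
            omega
      _ = _ := by
          rw [schurEval_succ, prod_range_succ, mul_sum]
          exact sum_congr rfl fun σ _ => by ring

end Pieri

section Threshold

open YoungDiagram

/-- The number of cells of row `i` weakly right of the diagonal. -/
def armPart (ν : YoungDiagram) (i : ℕ) : ℕ := ν.rowLen i - i

/-- The number of cells of column `i` weakly below the diagonal. -/
def legPart (ν : YoungDiagram) (i : ℕ) : ℕ := ν.colLen i - i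

theorem mem_iff_lt_armPart {ν : YoungDiagram} {i j : ℕ} (h : i ≤ j) :
    (i, j) ∈ ν ↔ j - i < armPart ν i := by
  rw [mem_iff_lt_rowLen, armPart]
  omega

theorem mem_iff_lt_legPart {ν : YoungDiagram} {i j : ℕ} (h : j ≤ i) :
    (i, j) ∈ ν ↔ i - j < legPart ν j := by
  rw [mem_iff_lt_colLen, legPart]
  omega

theorem armPart_pos_iff {ν : YoungDiagram} {i : ℕ} : 0 < armPart ν i ↔ 0 < legPart ν i := by
  have h1 := mem_iff_lt_armPart (ν := ν) (le_refl i)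
  have h2 := mem_iff_lt_legPart (ν := ν) (le_refl i)
  rw [Nat.sub_self] at h1 h2
  exact h1.symm.trans h2

theorem armPart_succ_le (ν : YoungDiagram) (i : ℕ) : armPart ν (i + 1) ≤ armPart ν i - 1 := by
  have := ν.rowLen_anti i (i + 1) (Nat.le_succ i)
  unfold armPart
  omega

theorem legPart_succ_le (ν : YoungDiagram) (i : ℕ) : legPart ν (i + 1) ≤ legPart ν i - 1 := by
  have := ν.colLen_anti i (i + 1) (Nat.le_succ i)
  unfold legPart
  omega

theorem armPart_antitone (ν : YoungDiagram) : Antitone (armPart ν) :=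
  antitone_nat_of_succ_le fun i => (armPart_succ_le ν i).trans (Nat.sub_le _ _)

theorem armPart_eq_zero_of_le {ν : YoungDiagram} {i j : ℕ} (hij : i ≤ j) (h : armPart ν i = 0) :
    armPart ν j = 0 :=
  Nat.eq_zero_of_le_zero (h ▸ armPart_antitone ν hij)

theorem card_eq_sum_armPart_add_legPart {ν : YoungDiagram} {N : ℕ} (h : armPart ν N = 0) :
    ν.card = ∑ i ∈ range N, (armPart ν i + (legPart ν i - 1)) := by
  have hmaps : ∀ c ∈ ν.cells, min c.1 c.2 ∈ range N := by
    rintro ⟨i, j⟩ hc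
    by_contra hi
    simp only [mem_range, not_lt, le_min_iff] at hi
    have := (mem_iff_lt_armPart le_rfl).1 (ν.up_left_mem hi.1 hi.2 ((mem_cells _).1 hc))
    omega
  rw [YoungDiagram.card, card_eq_sum_card_fiberwise hmaps]
  refine sum_congr rfl fun k _ => ?_
  have hfib : (ν.cells.filter fun c => min c.1 c.2 = k) =
      ({k} ×ˢ Ico k (ν.rowLen k)) ∪ (Ico (k + 1) (ν.colLen k) ×ˢ {k}) := by
    ext ⟨i, j⟩
    simp only [mem_filter, mem_union, mem_product, mem_singleton, mem_Ico, mem_cells]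
    constructor
    · rintro ⟨hc, hk⟩
      rcases le_or_gt i j with hij | hij
      · obtain rfl : i = k := by omega
        exact Or.inl ⟨rfl, hij, mem_iff_lt_rowLen.1 hc⟩
      · obtain rfl : j = k := by omega
        exact Or.inr ⟨⟨hij, mem_iff_lt_colLen.1 hc⟩, rfl⟩
    · rintro (⟨rfl, hij, hc⟩ | ⟨⟨hij, hc⟩, rfl⟩)
      · exact ⟨mem_iff_lt_rowLen.2 hc, by omega⟩
      · exact ⟨mem_iff_lt_colLen.2 hc, by omega⟩
  rw [hfib, card_union_of_disjoint, card_product, card_product]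
  · simp [armPart, legPart]
    omega
  · rw [disjoint_left]
    rintro ⟨i, j⟩ h1 h2
    simp only [mem_product, mem_singleton, mem_Ico] at h1 h2
    omega

theorem isThreshold_iff {ν : YoungDiagram} :
    ν.IsThreshold ↔ ∀ i j, i ≤ j → ((i, j) ∈ ν ↔ (j + 1, i) ∈ ν) := by
  constructor
  · intro h i j hij
    by_cases hd : (i, i) ∈ ν
    · rw [mem_iff_lt_rowLen, mem_iff_lt_colLen, h i hd]
      omega
    · exact iff_of_false (fun hc => hd (ν.up_left_mem le_rfl hij hc))
        fun hc => hd (ν.up_left_mem (by omega) le_rfl hc)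
  · intro h i hd
    have key : ∀ j, i ≤ j → (j < ν.rowLen i ↔ j + 1 < ν.colLen i) := fun j hj => by
      rw [← mem_iff_lt_rowLen, ← mem_iff_lt_colLen]
      exact h i j hj
    have h0 := mem_iff_lt_rowLen.1 hd
    have h1 := key (ν.rowLen i) h0.le
    have h2 := key (ν.rowLen i - 1) (by omega)
    omega

theorem mem_iff_of_isThreshold {ν : YoungDiagram} (h : ν.IsThreshold) {i j : ℕ} (hij : j < i) :
    (i, j) ∈ ν ↔ i - j - 1 < armPart ν j := by
  obtain ⟨k, rfl⟩ : ∃ k, i = k + 1 := ⟨i - 1, by omega⟩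
  rw [← isThreshold_iff.1 h j k (by omega), mem_iff_lt_armPart (by omega)]
  omega

theorem legPart_sub_one_of_isThreshold {ν : YoungDiagram} (h : ν.IsThreshold) (i : ℕ) :
    legPart ν i - 1 = armPart ν i := by
  have key : ∀ k, k + 1 < legPart ν i ↔ k < armPart ν i := fun k => by
    have h1 := mem_iff_of_isThreshold h (i := i + k + 1) (j := i) (by omega)
    rw [mem_iff_lt_legPart (by omega)] at h1
    convert h1 using 2 <;> omega
  have h1 := key (armPart ν i)
  have h2 := key (legPart ν i - 2)
  have h3 := key (legPart ν i - 1)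
  omega

theorem card_of_isThreshold {ν : YoungDiagram} (h : ν.IsThreshold) {N : ℕ} (hN : armPart ν N = 0) :
    ν.card = ∑ i ∈ range N, (armPart ν i + armPart ν i) := by
  rw [card_eq_sum_armPart_add_legPart hN]
  exact sum_congr rfl fun i _ => by rw [legPart_sub_one_of_isThreshold h]

theorem eq_of_armPart_eq {ν ρ : YoungDiagram} (hν : ν.IsThreshold) (hρ : ρ.IsThreshold)
    (h : ∀ i, armPart ν i = armPart ρ i) : ν = ρ := by
  refine SetLike.ext ?_
  rintro ⟨i, j⟩
  rcases le_or_gt i j with hij | hij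
  · rw [mem_iff_lt_armPart hij, mem_iff_lt_armPart hij, h]
  · rw [mem_iff_of_isThreshold hν hij, mem_iff_of_isThreshold hρ hij, h]

theorem hstrip_iff_of_isThreshold {ν ρ : YoungDiagram} (hν : ν.IsThreshold) :
    HStrip ν ρ ↔ ∀ i, armPart ρ i ≤ armPart ν i ∧ legPart ρ i - 1 ≤ armPart ν i ∧
      armPart ν i ≤ legPart ρ i ∧ armPart ν (i + 1) ≤ armPart ρ i - 1 := by
  rw [hstrip_iff_cells]
  constructor
  · rintro ⟨hle, hs⟩ i
    refine ⟨?_, ?_, ?_, ?_⟩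
    · by_contra! hlt
      have := hle ((mem_iff_lt_armPart (i := i) (j := i + armPart ν i) (by omega)).2 (by omega))
      rw [mem_iff_lt_armPart (by omega)] at this
      omega
    · by_contra! hlt
      have := hle ((mem_iff_lt_legPart (i := i + armPart ν i + 1) (j := i) (by omega)).2 (by omega))
      rw [mem_iff_of_isThreshold hν (by omega)] at this
      omega
    · by_contra! hlt
      have := hs (i + legPart ρ i) i ((mem_iff_of_isThreshold hν (by omega)).2 (by omega))
      rw [mem_iff_lt_legPart (by omega)] at this
      omega
    · by_contra! hlt
      have := hs i (i + 1 + (armPart ρ i - 1)) ((mem_iff_lt_armPart (by omega)).2 (by omega))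
      rw [mem_iff_lt_armPart (by omega)] at this
      omega
  · intro h
    constructor
    · rintro ⟨i, j⟩ hc
      rcases le_or_gt i j with hij | hij
      · rw [mem_iff_lt_armPart hij] at hc ⊢
        exact hc.trans_le (h i).1
      · rw [mem_iff_lt_legPart hij.le] at hc
        rw [mem_iff_of_isThreshold hν hij]
        have := h j
        omega
    · intro i j hc
      rcases le_or_gt (i + 1) j with hij | hij
      · rw [mem_iff_lt_armPart hij] at hc
        rw [mem_iff_lt_armPart (by omega)]
        have := h i
        omega
      · rw [mem_iff_of_isThreshold hν hij] at hc
        rw [mem_iff_lt_legPart (by omega)]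
        have := h j
        omega

theorem vstrip_iff_of_isThreshold {ρ τ : YoungDiagram} (hτ : τ.IsThreshold) :
    VStrip ρ τ ↔ ∀ i, armPart τ i ≤ armPart ρ i ∧ armPart τ i ≤ legPart ρ i - 1 ∧
      armPart ρ i - 1 ≤ armPart τ i ∧ legPart ρ (i + 1) ≤ armPart τ i := by
  rw [vstrip_iff_cells]
  constructor
  · rintro ⟨hle, hs⟩ i
    refine ⟨?_, ?_, ?_, ?_⟩
    · by_contra! hlt
      have := hle ((mem_iff_lt_armPart (i := i) (j := i + armPart ρ i) (by omega)).2 (by omega))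
      rw [mem_iff_lt_armPart (by omega)] at this
      omega
    · by_contra! hlt
      have := hle ((mem_iff_of_isThreshold hτ (i := i + (legPart ρ i - 1) + 1) (j := i)
        (by omega)).2 (by omega))
      rw [mem_iff_lt_legPart (by omega)] at this
      omega
    · by_contra! hlt
      have := hs i (i + armPart τ i) ((mem_iff_lt_armPart (by omega)).2 (by omega))
      rw [mem_iff_lt_armPart (by omega)] at this
      omega
    · by_contra! hlt
      have := hs (i + 1 + armPart τ i) i ((mem_iff_lt_legPart (by omega)).2 (by omega))
      rw [mem_iff_of_isThreshold hτ (by omega)] at this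
      omega
  · intro h
    constructor
    · rintro ⟨i, j⟩ hc
      rcases le_or_gt i j with hij | hij
      · rw [mem_iff_lt_armPart hij] at hc ⊢
        exact hc.trans_le (h i).1
      · rw [mem_iff_of_isThreshold hτ hij] at hc
        rw [mem_iff_lt_legPart hij.le]
        have := h j
        omega
    · intro i j hc
      rcases le_or_gt i j with hij | hij
      · rw [mem_iff_lt_armPart (by omega)] at hc
        rw [mem_iff_lt_armPart hij]
        have := h i
        omega
      · rw [mem_iff_lt_legPart (by omega)] at hc
        rw [mem_iff_of_isThreshold hτ hij]
        have := h j
        omega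

theorem add_sub_le_of_succ_le {b : ℕ → ℕ} (hb : ∀ i, b (i + 1) ≤ b i - 1) {i j : ℕ} (hij : i ≤ j)
    (hj : 0 < b j) : b j + (j - i) ≤ b i := by
  induction j, hij using Nat.le_induction with
  | base => omega
  | succ j hij ih =>
    have := hb j
    have := ih (by omega)
    omega

/-- The threshold diagram with `armPart` equal to `b`. -/
def thresholdOf (b : ℕ → ℕ) (r : ℕ) (hb : ∀ i, b (i + 1) ≤ b i - 1) : YoungDiagram where
  cells := (range (r + b 0 + 1) ×ˢ range (r + b 0 + 1)).filter fun c =>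
    (c.1 ≤ c.2 ∧ c.2 - c.1 < b c.1) ∨ (c.2 < c.1 ∧ c.1 - c.2 - 1 < b c.2)
  isLowerSet := by
    rintro ⟨i, j⟩ ⟨i', j'⟩ ⟨hi, hj⟩ h
    simp only [coe_filter, mem_product, mem_range, Set.mem_ofPred_eq] at h ⊢
    dsimp at hi hj
    refine ⟨by omega, ?_⟩
    rcases h.2 with ⟨h1, h2⟩ | ⟨h1, h2⟩ <;> rcases le_or_gt i' j' with h3 | h3
    · have := add_sub_le_of_succ_le hb hi (by omega)
      omega
    · have := add_sub_le_of_succ_le hb (i := j') (j := i) (by omega) (by omega)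
      omega
    · have := add_sub_le_of_succ_le hb (i := i') (j := j) (by omega) (by omega)
      omega
    · have := add_sub_le_of_succ_le hb hj (by omega)
      omega

theorem mem_thresholdOf {b : ℕ → ℕ} {r : ℕ} {hb : ∀ i, b (i + 1) ≤ b i - 1}
    (h0 : ∀ i, r ≤ i → b i = 0) {i j : ℕ} :
    (i, j) ∈ thresholdOf b r hb ↔ (i ≤ j ∧ j - i < b i) ∨ (j < i ∧ i - j - 1 < b j) := by
  rw [← mem_cells]
  simp only [thresholdOf, mem_filter, mem_product, mem_range, and_iff_right_iff_imp]
  rintro (⟨h1, h2⟩ | ⟨h1, h2⟩)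
  · have := add_sub_le_of_succ_le hb (Nat.zero_le i) (by omega)
    have := h0 i
    omega
  · have := add_sub_le_of_succ_le hb (Nat.zero_le j) (by omega)
    have := h0 j
    omega

theorem isThreshold_thresholdOf {b : ℕ → ℕ} {r : ℕ} (hb : ∀ i, b (i + 1) ≤ b i - 1)
    (h0 : ∀ i, r ≤ i → b i = 0) : (thresholdOf b r hb).IsThreshold := by
  refine isThreshold_iff.2 fun i j hij => ?_
  rw [mem_thresholdOf h0, mem_thresholdOf h0, show j + 1 - i - 1 = j - i by omega]
  omega

theorem armPart_thresholdOf {b : ℕ → ℕ} {r : ℕ} (hb : ∀ i, b (i + 1) ≤ b i - 1)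
    (h0 : ∀ i, r ≤ i → b i = 0) (i : ℕ) : armPart (thresholdOf b r hb) i = b i := by
  have key : ∀ k, k < armPart (thresholdOf b r hb) i ↔ k < b i := fun k => by
    have h := mem_iff_lt_armPart (ν := thresholdOf b r hb) (i := i) (j := i + k) (by omega)
    rw [mem_thresholdOf h0] at h
    rw [show k = i + k - i by omega, ← h]
    omega
  have h1 := key (b i)
  have h2 := key (armPart (thresholdOf b r hb) i)
  omega

/-- The threshold diagrams with at most `n` rows. -/
noncomputable def thresholdDiagrams (n : ℕ) : Finset YoungDiagram :=
  (diagramsIn (range n ×ˢ range n)).filter YoungDiagram.IsThreshold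

theorem mem_thresholdDiagrams {n : ℕ} {ν : YoungDiagram} :
    ν ∈ thresholdDiagrams n ↔ ν.IsThreshold ∧ ν.rowLen n = 0 := by
  rw [thresholdDiagrams, mem_filter, mem_diagramsIn_box]
  refine ⟨fun h => ⟨h.2, h.1.1⟩, fun h => ⟨⟨h.2, fun _ => ?_⟩, h.1⟩⟩
  by_contra! hlt
  have h1 := h.1 0 (mem_iff_lt_rowLen.2 (by omega))
  have h2 : (n, 0) ∈ ν := mem_iff_lt_colLen.2 (by omega)
  rw [mem_iff_lt_rowLen] at h2
  omega

end Threshold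

section ThresholdRule

open YoungDiagram

variable {R : Type*} [CommSemiring R]

/-- Adding a horizontal strip to reach a threshold diagram is equinumerous with removing a vertical
strip to reach one, respecting the size of the strip. -/
theorem sum_thresholdDiagrams_hstrip_eq_vstrip (x : R) (hx : IsLeftRegular (1 + x * x))
    {ρ : YoungDiagram} {n : ℕ} (hρ : ρ.rowLen n = 0) :
    ∑ ν ∈ (thresholdDiagrams (n + 1)).filter fun ν => HStrip ν ρ, x ^ (ν.card - ρ.card) =
      ∑ τ ∈ (thresholdDiagrams n).filter fun τ => VStrip ρ τ, x ^ (ρ.card - τ.card) := by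
  obtain ⟨r, hr⟩ : ∃ r, ∀ i, 0 < armPart ρ i ↔ i < r := by
    classical
    have hex : ∃ k, armPart ρ k = 0 := ⟨n, by simp [armPart, hρ]⟩
    refine ⟨Nat.find hex, fun i => ⟨fun hi => ?_, fun hi => ?_⟩⟩
    · by_contra! hle
      exact hi.ne' (armPart_eq_zero_of_le hle (Nat.find_spec hex))
    · exact Nat.pos_of_ne_zero (Nat.find_min hex hi)
  have hr' : ∀ i, 0 < legPart ρ i ↔ i < r := fun i => armPart_pos_iff.symm.trans (hr i)
  have hρr : armPart ρ r = 0 := by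
    have := hr r
    omega
  set lp : ℕ → ℕ := fun i =>
    if i = 0 then armPart ρ 0 + legPart ρ 0 + 1 else armPart ρ (i - 1) - 1 with hlp
  have hup : ∑ ν ∈ (thresholdDiagrams (n + 1)).filter fun ν => HStrip ν ρ, x ^ (ν.card - ρ.card) =
      ∏ i ∈ range r, upFactor x x (lp i) (armPart ρ i) (legPart ρ i - 1) := by
    unfold upFactor
    rw [← sum_eq_prod_of_coords _ r armPart]
    · refine sum_congr rfl fun ν hν => ?_
      rw [mem_filter, mem_thresholdDiagrams] at hν
      have hs := (hstrip_iff_of_isThreshold hν.1.1).1 hν.2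
      have hνr : armPart ν r = 0 := by
        have := hs r
        have := hr' r
        omega
      rw [card_of_isThreshold hν.1.1 hνr, card_eq_sum_armPart_add_legPart hρr,
        ← sum_tsub_distrib _ fun i _ => add_le_add (hs i).1 (hs i).2.1, ← prod_pow_eq_pow_sum]
      refine prod_congr rfl fun i _ => ?_
      have := hs i
      rw [← pow_add]
      congr 1
      omega
    · intro a ha b hb hab
      rw [mem_filter, mem_thresholdDiagrams] at ha hb
      refine eq_of_armPart_eq ha.1.1 hb.1.1 fun i => ?_
      rcases Nat.lt_or_ge i r with hi | hi
      · exact hab i hi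
      · have := (hstrip_iff_of_isThreshold ha.1.1).1 ha.2 i
        have := (hstrip_iff_of_isThreshold hb.1.1).1 hb.2 i
        have := hr' i
        omega
    · intro ν hν i hi
      rw [mem_filter, mem_thresholdDiagrams] at hν
      have hs := (hstrip_iff_of_isThreshold hν.1.1).1 hν.2
      have h1 := hs i
      have := hr' i
      rcases i with _ | i
      · simp [hlp]
        omega
      · have h3 := hs i
        simp [hlp]
        omega
    · intro f hf hf0
      have hdec : ∀ i, f (i + 1) ≤ f i - 1 := by
        intro i
        rcases Nat.lt_or_ge (i + 1) r with hi | hi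
        · have h1 := (hf (i + 1) hi).2
          have h2 := (hf i (by omega)).1
          simp [hlp] at h1 h2
          omega
        · rw [hf0 _ hi]
          exact Nat.zero_le _
      have harm := armPart_thresholdOf hdec hf0
      have hthr := isThreshold_thresholdOf hdec hf0
      have hstrip : HStrip (thresholdOf f r hdec) ρ := by
        refine (hstrip_iff_of_isThreshold hthr).2 fun i => ?_
        rw [harm, harm]
        have h1 := hr i
        have h2 := hr' i
        rcases Nat.lt_or_ge i r with hi | hi
        · have h3 := hf i hi
          refine ⟨by omega, by omega, by omega, ?_⟩
          rcases Nat.lt_or_ge (i + 1) r with hi' | hi'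
          · have := (hf (i + 1) hi').2
            simp [hlp] at this
            omega
          · rw [hf0 _ hi']
            exact Nat.zero_le _
        · rw [hf0 _ hi, hf0 _ (Nat.le_succ_of_le hi)]
          omega
      refine ⟨thresholdOf f r hdec, ?_, fun i _ => harm i⟩
      rw [mem_filter, mem_thresholdDiagrams]
      refine ⟨⟨hthr, ?_⟩, hstrip⟩
      have := (hstrip n).2
      omega
  have hdown : ∑ τ ∈ (thresholdDiagrams n).filter fun τ => VStrip ρ τ, x ^ (ρ.card - τ.card) =
      ∏ i ∈ range r, downFactor x x (armPart ρ i) (legPart ρ i - 1) (legPart ρ (i + 1)) := by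
    unfold downFactor
    rw [← sum_eq_prod_of_coords _ r armPart]
    · refine sum_congr rfl fun τ hτ => ?_
      rw [mem_filter, mem_thresholdDiagrams] at hτ
      have hs := (vstrip_iff_of_isThreshold hτ.1.1).1 hτ.2
      have hτr : armPart τ r = 0 := Nat.eq_zero_of_le_zero (hρr ▸ (hs r).1)
      rw [card_of_isThreshold hτ.1.1 hτr, card_eq_sum_armPart_add_legPart hρr,
        ← sum_tsub_distrib _ fun i _ => add_le_add (hs i).1 (hs i).2.1, ← prod_pow_eq_pow_sum]
      refine prod_congr rfl fun i _ => ?_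
      have := hs i
      rw [← pow_add]
      congr 1
      omega
    · intro a ha b hb hab
      rw [mem_filter, mem_thresholdDiagrams] at ha hb
      refine eq_of_armPart_eq ha.1.1 hb.1.1 fun i => ?_
      rcases Nat.lt_or_ge i r with hi | hi
      · exact hab i hi
      · have := (vstrip_iff_of_isThreshold ha.1.1).1 ha.2 i
        have := (vstrip_iff_of_isThreshold hb.1.1).1 hb.2 i
        have := hr i
        omega
    · intro τ hτ i hi
      rw [mem_filter, mem_thresholdDiagrams] at hτ
      have := (vstrip_iff_of_isThreshold hτ.1.1).1 hτ.2 i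
      omega
    · intro f hf hf0
      have hdec : ∀ i, f (i + 1) ≤ f i - 1 := by
        intro i
        rcases Nat.lt_or_ge (i + 1) r with hi | hi
        · have h1 := (hf (i + 1) hi).2
          have h2 := (hf i (by omega)).1
          omega
        · rw [hf0 _ hi]
          exact Nat.zero_le _
      have harm := armPart_thresholdOf hdec hf0
      have hthr := isThreshold_thresholdOf hdec hf0
      have hstrip : VStrip ρ (thresholdOf f r hdec) := by
        refine (vstrip_iff_of_isThreshold hthr).2 fun i => ?_
        rw [harm]
        have h1 := hr i
        have h2 := hr' (i + 1)
        rcases Nat.lt_or_ge i r with hi | hi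
        · have h3 := hf i hi
          omega
        · rw [hf0 _ hi]
          omega
      refine ⟨thresholdOf f r hdec, ?_, fun i _ => harm i⟩
      rw [mem_filter, mem_thresholdDiagrams]
      refine ⟨⟨hthr, ?_⟩, hstrip⟩
      have := (hstrip n).1
      omega
  have htel := prod_telescope
    (fun i => if i = 0 then 1 + x * x
      else gapWeight (x * x) (armPart ρ (i - 1)) (legPart ρ i))
    (fun i => upFactor x x (lp i) (armPart ρ i) (legPart ρ i - 1))
    (fun i => downFactor x x (armPart ρ i) (legPart ρ i - 1) (legPart ρ (i + 1))) r
    fun i hi => by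
      have hleg := legPart_succ_le ρ i
      have h1 := hr' i
      have hle : armPart ρ i ≤ lp i := by
        rcases i with _ | i
        · simp [hlp]
          omega
        · simpa [hlp] using armPart_succ_le ρ i
      have hM : (if i = 0 then 1 + x * x
          else gapWeight (x * x) (armPart ρ (i - 1)) (legPart ρ i)) =
          gapWeight (x * x) (lp i) (legPart ρ i - 1) := by
        rcases i with _ | i
        · rw [if_pos rfl, gapWeight, if_neg (by simp [hlp]; omega), if_neg (by simp [hlp]; omega)]
        · have h2 := hr i
          simp only [hlp, Nat.add_eq_zero_iff, one_ne_zero, and_false, if_false,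
            Nat.add_sub_cancel, gapWeight]
          congr 1
          · exact propext (by omega)
          · congr 1
            exact propext (by omega)
      rw [hM, ← gapWeight_mul_upFactor x x hle hleg]
      simp
  have hlast : (if r = 0 then 1 + x * x
      else gapWeight (x * x) (armPart ρ (r - 1)) (legPart ρ r)) = 1 + x * x := by
    split_ifs with h
    · rfl
    · have h1 := hr (r - 1)
      have h2 := hr' r
      rw [gapWeight, if_neg (by omega), if_neg (by omega)]
  rw [hlast, if_pos rfl] at htel
  rw [hup, hdown]
  exact hx htel

/-- Littlewood's identity for threshold diagrams. -/
theorem sum_thresholdDiagrams_schurEval (x : ℕ → R)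
    (hx : ∀ i, IsLeftRegular (1 + x i * x i)) (n : ℕ) :
    ∑ ν ∈ thresholdDiagrams n, schurEval x n ν =
      ∏ j ∈ range n, ∏ i ∈ range j, (1 + x i * x j) := by
  induction n with
  | zero =>
    have : thresholdDiagrams 0 = {⊥} := by
      ext ν
      rw [mem_thresholdDiagrams, mem_singleton]
      refine ⟨fun h => eq_bot_of_rowLen_zero h.2, ?_⟩
      rintro rfl
      exact ⟨fun i hi => absurd hi (notMem_bot _), rowLen_bot 0⟩
    simp [this, schurEval_zero_bot]
  | succ n ih =>
    set B := diagramsIn (range (n + 1) ×ˢ range (n + 1)) with hB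
    calc _ = ∑ ν ∈ thresholdDiagrams (n + 1), ∑ ρ ∈ hDown ν,
          x n ^ (ν.card - ρ.card) * schurEval x n ρ :=
          sum_congr rfl fun ν _ => schurEval_succ x n ν
      _ = ∑ ρ ∈ B, ∑ ν ∈ (thresholdDiagrams (n + 1)).filter fun ν => HStrip ν ρ,
          x n ^ (ν.card - ρ.card) * schurEval x n ρ := by
          refine sum_comm' fun ν ρ => ?_
          simp only [mem_filter, mem_hDown]
          refine ⟨fun h => ⟨h, ?_⟩, fun h => h.1⟩
          have hν : ν ∈ B := (mem_filter.1 h.1).1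
          exact mem_diagramsIn.2 ((cells_subset_iff.2 h.2.le).trans (mem_diagramsIn.1 hν))
      _ = ∑ ρ ∈ B, ∑ τ ∈ (thresholdDiagrams n).filter fun τ => VStrip ρ τ,
          x n ^ (ρ.card - τ.card) * schurEval x n ρ := by
          refine sum_congr rfl fun ρ _ => ?_
          rw [← sum_mul, ← sum_mul]
          by_cases hρ : ρ.rowLen n = 0
          · rw [sum_thresholdDiagrams_hstrip_eq_vstrip (x n) (hx n) hρ]
          · rw [schurEval_eq_zero x hρ, mul_zero, mul_zero]
      _ = ∑ τ ∈ thresholdDiagrams n, ∑ ρ ∈ B.filter fun ρ => VStrip ρ τ,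
          x n ^ (ρ.card - τ.card) * schurEval x n ρ := by
          refine sum_comm' fun ρ τ => ?_
          simp only [mem_filter]
          tauto
      _ = ∑ τ ∈ thresholdDiagrams n, (∏ i ∈ range n, (1 + x i * x n)) * schurEval x n τ := by
          refine sum_congr rfl fun τ hτ => sum_vstrip_schurEval x (x n) n τ B fun ρ hρ h0 => ?_
          refine mem_diagramsIn_box.2 ⟨rowLen_eq_zero_of_le (Nat.le_succ n) h0, fun _ => ?_⟩
          have h1 := (mem_diagramsIn_box.1 (mem_filter.1 hτ).1).2
          have h2 := (hρ 0).2
          rcases Nat.eq_zero_or_pos n with rfl | hn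
          · omega
          · have := h1 hn
            omega
      _ = _ := by
          rw [← mul_sum, ih, prod_range_succ, mul_comm]

end ThresholdRule

section Coefficients

open MvPolynomial

/-- A vector indexed by `Fin n`, extended by zero to a finitely supported exponent vector. -/
noncomputable def exponent {n : ℕ} (μ : Fin n → ℕ) : ℕ →₀ ℕ :=
  Finsupp.onFinset (range n) (fun j => if h : j < n then μ ⟨j, h⟩ else 0) fun j hj => by
    by_contra h
    exact hj (dif_neg (by simpa using h))

theorem exponent_apply {n : ℕ} (μ : Fin n → ℕ) (j : ℕ) :
    exponent μ j = if h : j < n then μ ⟨j, h⟩ else 0 := rfl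

theorem exponent_eq_iff {n : ℕ} {μ : Fin n → ℕ} {f : ℕ →₀ ℕ} (hf : ∀ j, n ≤ j → f j = 0) :
    f = exponent μ ↔ ∀ j : Fin n, f j = μ j := by
  rw [Finsupp.ext_iff]
  refine ⟨fun h j => by simp [h, exponent_apply], fun h j => ?_⟩
  rw [exponent_apply]
  split
  · exact h ⟨j, ‹_›⟩
  · exact hf j (by omega)

theorem isLeftRegular_one_add_X_mul_X (i : ℕ) :
    IsLeftRegular (1 + X i * X i : MvPolynomial ℕ ℤ) := by
  refine mul_right_injective₀ fun h => ?_
  simpa using congrArg constantCoeff h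

theorem coeff_sum_prod_monomial {ι κ σ : Type*} [DecidableEq σ] (s : Finset ι) (t : ι → Finset κ)
    (f : ι → κ → σ →₀ ℕ) (w : σ →₀ ℕ) :
    coeff w (∑ a ∈ s, ∏ c ∈ t a, monomial (f a c) (1 : ℤ)) =
      (s.filter fun a => ∑ c ∈ t a, f a c = w).card := by
  classical
  simp_rw [coeff_sum, ← monomial_sum_one, coeff_monomial]
  simp

theorem mem_ssytBelow_of_ssytWeight {n : ℕ} {ν : YoungDiagram} {μ : Fin n → ℕ}
    {T : SemistandardYoungTableau ν} (h : ∀ j, ssytWeight T j = exponent μ j) :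
    T ∈ ssytBelow n ν := by
  refine mem_ssytBelow.2 fun i j hij => ?_
  by_contra hn
  have h1 := h (T i j)
  rw [exponent_apply, dif_neg hn, ssytWeight, card_eq_zero] at h1
  exact notMem_empty (i, j) (h1 ▸ mem_filter.2 ⟨hij, rfl⟩)

theorem coeff_schurEval {n : ℕ} (ν : YoungDiagram) (μ : Fin n → ℕ) :
    coeff (exponent μ) (schurEval (X : ℕ → MvPolynomial ℕ ℤ) n ν) = tabCard ν μ := by
  classical
  have h (T : SemistandardYoungTableau ν) (j : ℕ) :
      (∑ c ∈ ν.cells, Finsupp.single (T c.1 c.2) 1) j = ssytWeight T j := by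
    simp [ssytWeight, Finsupp.finsetSum_apply, Finsupp.single_apply]
  refine (coeff_sum_prod_monomial _ (fun _ => ν.cells) _ _).trans ?_
  rw [tabCard, ← Set.ncard_coe_finset]
  congr 2
  ext T
  simp only [coe_filter, Set.mem_ofPred_eq, Finsupp.ext_iff, h]
  exact ⟨fun hT => hT.2, fun hT => ⟨mem_ssytBelow_of_ssytWeight hT, hT⟩⟩

end Coefficients

section Graphs

open MvPolynomial

/-- The possible edges `i < j` of a simple graph on `Fin n`. -/
def edgePairs (n : ℕ) : Finset (Fin n × Fin n) :=
  univ.filter fun e => e.1 < e.2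

theorem mem_edgePairs {n : ℕ} {e : Fin n × Fin n} : e ∈ edgePairs n ↔ e.1 < e.2 := by
  simp [edgePairs]

theorem prod_range_prod_range_eq {R : Type*} [CommMonoid R] (f : ℕ → ℕ → R) (n : ℕ) :
    ∏ j ∈ range n, ∏ i ∈ range j, f i j = ∏ e ∈ edgePairs n, f e.1 e.2 := by
  rw [prod_sigma']
  have hlt {p : (_ : ℕ) × ℕ} (hp : p ∈ (range n).sigma range) : p.1 < n ∧ p.2 < p.1 := by
    simpa using hp
  refine (prod_bij' (fun e _ => ⟨e.2, e.1⟩)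
    (fun p hp => (⟨p.2, (hlt hp).2.trans (hlt hp).1⟩, ⟨p.1, (hlt hp).1⟩)) ?_ ?_ ?_ ?_ ?_).symm
  · intro e he
    simpa using mem_edgePairs.1 he
  · exact fun p hp => mem_edgePairs.2 (hlt hp).2
  all_goals exact fun _ _ => rfl

/-- The adjacency matrix of the graph with edge set `E`. -/
def adjacency {n : ℕ} (E : Finset (Fin n × Fin n)) : Matrix (Fin n) (Fin n) ℕ :=
  Matrix.of fun i j => (if (i, j) ∈ E then 1 else 0) + if (j, i) ∈ E then 1 else 0

theorem adjacency_apply_of_lt {n : ℕ} {E : Finset (Fin n × Fin n)} (hE : E ⊆ edgePairs n)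
    {i j : Fin n} (h : i < j) : adjacency E i j = if (i, j) ∈ E then 1 else 0 := by
  have : (j, i) ∉ E := fun h' => (mem_edgePairs.1 (hE h')).not_gt h
  simp [adjacency, this]

theorem adjacency_isSymm {n : ℕ} (E : Finset (Fin n × Fin n)) : (adjacency E).IsSymm :=
  Matrix.IsSymm.ext fun _ _ => add_comm _ _

theorem adjacency_diag {n : ℕ} {E : Finset (Fin n × Fin n)} (hE : E ⊆ edgePairs n) (i : Fin n) :
    adjacency E i i = 0 := by
  have : (i, i) ∉ E := fun h' => (mem_edgePairs.1 (hE h')).ne rfl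
  simp [adjacency, this]

theorem adjacency_le_one {n : ℕ} {E : Finset (Fin n × Fin n)} (hE : E ⊆ edgePairs n)
    (i j : Fin n) : adjacency E i j ≤ 1 := by
  rcases lt_trichotomy i j with h | rfl | h
  · rw [adjacency_apply_of_lt hE h]
    split <;> simp
  · simp [adjacency_diag hE]
  · rw [(adjacency_isSymm E).apply, adjacency_apply_of_lt hE h]
    split <;> simp

theorem sum_adjacency {n : ℕ} (E : Finset (Fin n × Fin n)) (k : Fin n) :
    ∑ j, adjacency E k j =
      (∑ e ∈ E, (Finsupp.single (e.1 : ℕ) 1 + Finsupp.single (e.2 : ℕ) 1) : ℕ →₀ ℕ) k := by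
  have key (f : Fin n × Fin n → ℕ) :
      ∑ e ∈ E, f e = ∑ i, ∑ j, if (i, j) ∈ E then f (i, j) else 0 := by
    rw [← Fintype.sum_prod_type' fun i j => if (i, j) ∈ E then f (i, j) else 0]
    simp
  have h1 : ∑ e ∈ E, (if e.1 = k then 1 else 0) = ∑ j, if (k, j) ∈ E then 1 else 0 := by
    rw [key, Fintype.sum_eq_single k fun i hi => by simp [hi]]
    simp
  have h2 : ∑ e ∈ E, (if e.2 = k then 1 else 0) = ∑ j, if (j, k) ∈ E then 1 else 0 := by
    rw [key, sum_comm, Fintype.sum_eq_single k fun i hi => by simp [hi]]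
    simp
  simp only [adjacency, Matrix.of_apply, sum_add_distrib, Finsupp.add_apply,
    Finsupp.finsetSum_apply, Finsupp.single_apply, Fin.val_inj, h1, h2]

theorem eq_adjacency {n : ℕ} {A : Matrix (Fin n) (Fin n) ℕ} (hs : A.IsSymm)
    (h1 : ∀ i j, A i j ≤ 1) (h0 : ∀ i, A i i = 0) :
    adjacency ((edgePairs n).filter fun e => A e.1 e.2 = 1) = A := by
  ext i j
  have := h1 i j
  have := hs.apply i j
  rcases lt_trichotomy i j with h | rfl | h
  · rw [adjacency_apply_of_lt (filter_subset _ _) h]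
    simp [mem_edgePairs, h]
    split <;> omega
  · rw [adjacency_diag (filter_subset _ _), h0]
  · rw [← (adjacency_isSymm _).apply, adjacency_apply_of_lt (filter_subset _ _) h]
    simp [mem_edgePairs, h]
    split <;> omega

theorem adjacency_injOn (n : ℕ) :
    Set.InjOn adjacency {E : Finset (Fin n × Fin n) | E ⊆ edgePairs n} := by
  intro E hE E' hE' h
  ext ⟨i, j⟩
  by_cases hij : i < j
  · have := congrFun (congrFun h i) j
    rw [adjacency_apply_of_lt hE hij, adjacency_apply_of_lt hE' hij] at this
    split_ifs at this <;> simp_all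
  · exact ⟨fun h' => absurd (mem_edgePairs.1 (hE h')) hij,
      fun h' => absurd (mem_edgePairs.1 (hE' h')) hij⟩

theorem coeff_prod_one_add {n : ℕ} (μ : Fin n → ℕ) :
    coeff (exponent μ)
      (∏ j ∈ range n, ∏ i ∈ range j, (1 + X i * X j : MvPolynomial ℕ ℤ)) =
      Set.ncard {A : Matrix (Fin n) (Fin n) ℕ |
        A.IsSymm ∧ (∀ i j, A i j ≤ 1) ∧ (∀ i, A i i = 0) ∧ (∀ i, ∑ j, A i j = μ i)} := by
  classical
  have hX (i j : ℕ) : (X i * X j : MvPolynomial ℕ ℤ) =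
      monomial (Finsupp.single i 1 + Finsupp.single j 1) 1 := by
    rw [X, X, monomial_mul, one_mul]
  rw [prod_range_prod_range_eq fun i j => (1 + X i * X j : MvPolynomial ℕ ℤ), prod_one_add]
  simp_rw [hX]
  rw [coeff_sum_prod_monomial _ (fun E => E), ← Set.ncard_coe_finset,
    ← Set.InjOn.ncard_image (f := adjacency)]
  · congr 2
    ext A
    have hdeg (E : Finset (Fin n × Fin n)) :
        ∑ e ∈ E, (Finsupp.single (e.1 : ℕ) 1 + Finsupp.single (e.2 : ℕ) 1) = exponent μ ↔
          ∀ k, ∑ j, adjacency E k j = μ k := by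
      simp_rw [sum_adjacency]
      refine exponent_eq_iff fun j hj => ?_
      have (i : Fin n) : (i : ℕ) ≠ j := by omega
      simp [Finsupp.finsetSum_apply, this]
    simp only [coe_filter, mem_powerset, hdeg, Set.mem_image, Set.mem_ofPred_eq]
    constructor
    · rintro ⟨E, ⟨hE, hk⟩, rfl⟩
      exact ⟨adjacency_isSymm E, adjacency_le_one hE, adjacency_diag hE, hk⟩
    · rintro ⟨hs, h1, h0, hk⟩
      have hA := eq_adjacency hs h1 h0
      exact ⟨_, ⟨filter_subset _ _, by rwa [hA]⟩, hA⟩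
  · exact (adjacency_injOn n).mono fun E hE => by simp_all

theorem card_eq_and_rowLen_eq_zero_of_tabCard_ne_zero {n : ℕ} {ν : YoungDiagram} {μ : Fin n → ℕ}
    (h : tabCard ν μ ≠ 0) : ν.card = ∑ j, μ j ∧ ν.rowLen n = 0 := by
  obtain ⟨T, hT⟩ := Set.nonempty_of_ncard_ne_zero h
  have hb : T ∈ ssytBelow n ν := mem_ssytBelow_of_ssytWeight hT
  constructor
  · rw [YoungDiagram.card, card_eq_sum_card_fiberwise (f := fun c => T c.1 c.2) (t := range n)
      fun c hc => by simpa using mem_ssytBelow.1 hb c.1 c.2 hc, sum_range]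
    exact sum_congr rfl fun j _ => (hT j).trans (dif_pos j.2)
  · by_contra h0
    rw [ssytBelow_eq_empty h0] at hb
    exact notMem_empty T hb

theorem finsum_tabCard {n d : ℕ} (μ : Fin n → ℕ) (hμ : ∑ j, μ j = d) :
    ∑ᶠ (lam : YoungDiagram) (_ : lam.card = d ∧ lam.IsThreshold), tabCard lam μ =
      ∑ lam ∈ thresholdDiagrams n, tabCard lam μ := by
  refine finsum_mem_eq_sum_of_inter_support_eq 
    (s := {lam : YoungDiagram | lam.card = d ∧ lam.IsThreshold}) _ ?_
  ext lam
  simp only [Set.mem_inter_iff, Set.mem_ofPred_eq, Function.mem_support, mem_coe,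
    mem_thresholdDiagrams]
  refine and_congr_left fun h => ?_
  obtain ⟨h1, h2⟩ := card_eq_and_rowLen_eq_zero_of_tabCard_ne_zero h
  simp [h1, h2, hμ]

end Graphs

end Burge

/-- **Burge's correspondence for graphs without loops or multiple edges, enumerative form.**
The number of symmetric `n × n` matrices with entries in `{0,1}`, zero diagonal, and row sums
`μ` (summing to `d`) equals the sum of `|Tab(λ,μ)|` over all threshold partitions `λ` of `d`. -/
theorem burge_threshold_card (n d : ℕ) (μ : Fin n → ℕ) (hμ : ∑ j, μ j = d) :
    Set.ncard {A : Matrix (Fin n) (Fin n) ℕ |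
        A.IsSymm ∧ (∀ i j, A i j ≤ 1) ∧ (∀ i, A i i = 0) ∧ (∀ i, ∑ j, A i j = μ i)} =
      ∑ᶠ (lam : YoungDiagram) (_ : lam.card = d ∧ lam.IsThreshold), tabCard lam μ := by
  have h := Burge.sum_thresholdDiagrams_schurEval (MvPolynomial.X : ℕ → MvPolynomial ℕ ℤ)
    Burge.isLeftRegular_one_add_X_mul_X n
  apply_fun MvPolynomial.coeff (Burge.exponent μ) at h
  rw [MvPolynomial.coeff_sum, Burge.coeff_prod_one_add] at h
  simp_rw [Burge.coeff_schurEval] at h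
  rw [Burge.finsum_tabCard μ hμ]
  exact_mod_cast h.symm
end
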